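/- arXiv:1604.06172 — 3 statements merged into one kernel-verified Lean document; each statement's English description precedes it below -/
import Mathlib

section
/- Let p be a prime, t ≥ 1, q = p^t, and d ≥ 2. Let A(q) denote the oppositeness matrix of generators of the Hermitian polar space H(2d-1, q^2), and A(p) the oppositeness matrix of generators of H(2d-1, p^2). Then the rank of A(q) over the field with p elements equals the t-th power of the rank of A(p) over the field with p elements. -/
namespace Matrix

variable {k m n : Type*} [Field k]

/-- A matrix over a field factors through its rank, with one-sided invertible factors. -/
theorem exists_rank_factorization [Finite m] [Fintype n] (A : Matrix m n k) :
    ∃ (L : Matrix m (Fin A.rank) k) (R : Matrix (Fin A.rank) n k)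
      (L' : Matrix (Fin A.rank) m k) (R' : Matrix n (Fin A.rank) k),
      A = L * R ∧ (∀ [Fintype m], L' * L = 1) ∧ R * R' = 1 := by
  classical
  have := Fintype.ofFinite m
  let e : LinearMap.range A.mulVecLin ≃ₗ[k] (Fin A.rank → k) :=
    (Module.finBasis k (LinearMap.range A.mulVecLin)).equivFun
  let Lm : (Fin A.rank → k) →ₗ[k] (m → k) :=
    (LinearMap.range A.mulVecLin).subtype ∘ₗ e.symm.toLinearMap
  let Rm : (n → k) →ₗ[k] (Fin A.rank → k) := e.toLinearMap ∘ₗ A.mulVecLin.rangeRestrict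
  have hL : LinearMap.ker Lm = ⊥ := by
    rw [LinearMap.ker_eq_bot]
    exact (Submodule.subtype_injective _).comp e.symm.injective
  have hR : LinearMap.range Rm = ⊤ := by
    rw [LinearMap.range_eq_top]
    exact e.surjective.comp A.mulVecLin.surjective_rangeRestrict
  obtain ⟨L', hL'⟩ := LinearMap.exists_leftInverse_of_injective Lm hL
  obtain ⟨R', hR'⟩ := LinearMap.exists_rightInverse_of_surjective Rm hR
  refine ⟨LinearMap.toMatrix' Lm, LinearMap.toMatrix' Rm, LinearMap.toMatrix' L',
    LinearMap.toMatrix' R', ?_, ?_, ?_⟩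
  · rw [← LinearMap.toMatrix'_comp]
    have : Lm ∘ₗ Rm = A.mulVecLin := by
      ext x
      simp [Lm, Rm]
    rw [this, ← Matrix.toLin'_apply', LinearMap.toMatrix'_toLin']
  · intro inst
    cases Subsingleton.elim inst this
    rw [← LinearMap.toMatrix'_comp, hL', LinearMap.toMatrix'_id]
  · rw [← LinearMap.toMatrix'_comp, hR', LinearMap.toMatrix'_id]

theorem rank_mul_mul_of_inverses {m' n' : Type*} [Fintype m] [Fintype n] [Fintype m'] [Fintype n']
    [DecidableEq m] [DecidableEq n] {L : Matrix m' m k} {L' : Matrix m m' k} {R : Matrix n n' k}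
    {R' : Matrix n' n k} (hL : L' * L = 1) (hR : R * R' = 1) (A : Matrix m n k) :
    (L * A * R).rank = A.rank := by
  apply le_antisymm
  · exact (rank_mul_le_left _ _).trans (rank_mul_le_right _ _)
  · have h : A = L' * (L * A * R) * R' := by
      calc A = (L' * L) * A * (R * R') := by simp [hL, hR]
        _ = _ := by simp only [Matrix.mul_assoc]
    calc A.rank = (L' * (L * A * R) * R').rank := by rw [← h]
      _ ≤ _ := (rank_mul_le_left _ _).trans (rank_mul_le_right _ _)

theorem rank_mul_of_inverses [Fintype m] [Fintype n] {r : ℕ} {L : Matrix m (Fin r) k}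
    {L' : Matrix (Fin r) m k} {R : Matrix (Fin r) n k} {R' : Matrix n (Fin r) k}
    (hL : L' * L = 1) (hR : R * R' = 1) : (L * R).rank = r := by
  simpa using rank_mul_mul_of_inverses hL hR 1

theorem rank_map_ringHom {K : Type*} [Field K] (f : k →+* K) [Fintype m] [Fintype n]
    (A : Matrix m n k) : (A.map f).rank = A.rank := by
  obtain ⟨L, R, L', R', hA, hL, hR⟩ := A.exists_rank_factorization
  have hL1 : L'.map f * L.map f = 1 := by rw [← Matrix.map_mul, hL]; simp
  have hR1 : R.map f * R'.map f = 1 := by rw [← Matrix.map_mul, hR]; simp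
  have := rank_mul_of_inverses hL1 hR1
  rwa [← Matrix.map_mul, ← hA] at this

/-- The tensor power of a matrix, with rows and columns indexed by tuples. -/
def tensorPow (t : ℕ) (A : Matrix m n k) : Matrix (Fin t → m) (Fin t → n) k :=
  fun a b ↦ ∏ i, A (a i) (b i)

theorem tensorPow_mul {l : Type*} [Fintype n] (t : ℕ) (A : Matrix m n k) (B : Matrix n l k) :
    tensorPow t (A * B) = tensorPow t A * tensorPow t B := by
  ext a b
  simp only [tensorPow, Matrix.mul_apply, Finset.prod_univ_sum, Fintype.piFinset_univ,
    Finset.prod_mul_distrib]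

theorem tensorPow_one [DecidableEq m] (t : ℕ) :
    tensorPow t (1 : Matrix m m k) = 1 := by
  ext a b
  simp only [tensorPow, Matrix.one_apply, funext_iff]
  rw [Finset.prod_ite_zero]
  simp

theorem rank_tensorPow [Fintype m] [Fintype n] (t : ℕ) (A : Matrix m n k) :
    (tensorPow t A).rank = A.rank ^ t := by
  obtain ⟨L, R, L', R', hA, hL, hR⟩ := A.exists_rank_factorization
  have hL1 : tensorPow t L' * tensorPow t L = 1 := by rw [← tensorPow_mul, hL, tensorPow_one]
  have hR1 : tensorPow t R * tensorPow t R' = 1 := by rw [← tensorPow_mul, hR, tensorPow_one]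
  have := rank_mul_mul_of_inverses hL1 hR1 1
  rw [Matrix.mul_one, ← tensorPow_mul, ← hA] at this
  simpa using this

theorem rank_submatrix_of_forall_mem_span {m₀ : Type*} [Finite m] [Finite m₀] [Fintype n]
    (A : Matrix m n k) (f : m₀ → m)
    (h : ∀ i, A.row i ∈ Submodule.span k (Set.range fun j ↦ A.row (f j))) :
    (A.submatrix f id).rank = A.rank := by
  rw [rank_eq_finrank_span_row, rank_eq_finrank_span_row]
  have : Submodule.span k (Set.range (A.submatrix f id).row) =
      Submodule.span k (Set.range A.row) := by
    apply le_antisymm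
    · apply Submodule.span_mono
      rintro _ ⟨j, rfl⟩
      exact ⟨f j, rfl⟩
    · rw [Submodule.span_le]
      rintro _ ⟨i, rfl⟩
      exact h i
  rw [this]

/-- A symmetric matrix has the same rank as a principal submatrix whose rows span all rows. -/
theorem IsSymm.rank_submatrix_of_forall_mem_span {m₀ : Type*} [Fintype m] [Fintype m₀]
    {A : Matrix m m k} (hA : A.IsSymm) (f : m₀ → m)
    (h : ∀ i, A.row i ∈ Submodule.span k (Set.range fun j ↦ A.row (f j))) :
    (A.submatrix f f).rank = A.rank := by
  have h1 : (A.submatrix id f).rank = A.rank := by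
    rw [← Matrix.rank_submatrix_of_forall_mem_span A f h, ← rank_transpose, transpose_submatrix,
      hA.eq]
  rw [← h1, ← Matrix.rank_submatrix_of_forall_mem_span (A.submatrix id f) f, submatrix_submatrix]
  · rfl
  · intro i
    have := Submodule.mem_map_of_mem (f := LinearMap.funLeft k k f) (h i)
    rw [Submodule.map_span, ← Set.range_comp] at this
    exact this

end Matrix

section SkewHermitian

variable {F V : Type*} [Field F] [AddCommGroup V] [Module F V] {σ : F →+* F}

/-- A subspace is Lagrangian if it equals its own orthogonal complement. -/
def IsLagrangian (s : V →ₗ[F] V →ₛₗ[σ] F) (W : Submodule F V) : Prop :=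
  ∀ x, x ∈ W ↔ ∀ y ∈ W, s x y = 0

/-- The transvection `x ↦ x + c s(x, u) u` along a vector `u`. -/
def skewTransvection (s : V →ₗ[F] V →ₛₗ[σ] F) (u : V) (c : ℤ) : V →ₗ[F] V :=
  LinearMap.id + c • (s.flip u).smulRight u

variable {s : V →ₗ[F] V →ₛₗ[σ] F} {u : V}

theorem skewTransvection_apply (c : ℤ) (x : V) :
    skewTransvection s u c x = x + (c * s x u) • u := by
  simp [skewTransvection, mul_smul, Int.cast_smul_eq_zsmul, smul_comm c]

theorem skewTransvection_comp (hu : s u u = 0) (c c' : ℤ) :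
    skewTransvection s u c ∘ₗ skewTransvection s u c' = skewTransvection s u (c + c') := by
  ext x
  simp only [LinearMap.comp_apply, skewTransvection_apply, map_add, map_smul, hu]
  push_cast
  module

theorem skewTransvection_zero : skewTransvection s u 0 = LinearMap.id := by
  simp [skewTransvection]

theorem skewTransvection_isometry (hs : ∀ x y, s y x = -σ (s x y)) (hu : s u u = 0) (c : ℤ)
    (x y : V) : s (skewTransvection s u c x) (skewTransvection s u c y) = s x y := by
  simp only [skewTransvection_apply, map_add, map_smul, map_smulₛₗ, hu, LinearMap.add_apply,
    LinearMap.smul_apply, smul_eq_mul, map_mul, map_intCast, hs u y]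
  have h : σ (-σ (s u y)) = -s u y := by rw [← hs u y, hs y u, neg_neg]
  rw [h]
  ring

theorem IsLagrangian.map_skewTransvection {W : Submodule F V} (hW : IsLagrangian s W)
    (hs : ∀ x y, s y x = -σ (s x y)) (hu : s u u = 0) (c : ℤ) :
    IsLagrangian s (W.map (skewTransvection s u c)) := by
  have hinv : ∀ x, skewTransvection s u c (skewTransvection s u (-c) x) = x := fun x ↦ by
    rw [← LinearMap.comp_apply, skewTransvection_comp hu, add_neg_cancel, skewTransvection_zero,
      LinearMap.id_apply]
  have hinv' : ∀ x, skewTransvection s u (-c) (skewTransvection s u c x) = x := fun x ↦ by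
    rw [← LinearMap.comp_apply, skewTransvection_comp hu, neg_add_cancel, skewTransvection_zero,
      LinearMap.id_apply]
  intro x
  have h1 : x ∈ W.map (skewTransvection s u c) ↔ skewTransvection s u (-c) x ∈ W := by
    constructor
    · rintro ⟨y, hy, rfl⟩
      rwa [hinv']
    · exact fun h ↦ ⟨_, h, hinv x⟩
  have hadj (y : V) : s x (skewTransvection s u c y) = s (skewTransvection s u (-c) x) y := by
    rw [← skewTransvection_isometry hs hu c _ y, hinv]
  rw [h1, hW]
  constructor
  · rintro h _ ⟨y, hy, rfl⟩
    rw [hadj, h y hy]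
  · intro h y hy
    rw [← hadj, h _ ⟨y, hy, rfl⟩]

/-- The number of Lagrangian subspaces through `P` that are opposite to `U` is divisible by the
characteristic as soon as `U` contains a nonzero vector orthogonal to `P`. -/
theorem dvd_card_isLagrangian_of_orthogonal [Finite V] (p : ℕ) [Fact p.Prime] [CharP F p]
    (hs : ∀ x y, s y x = -σ (s x y)) {P U : Submodule F V} (hU : IsLagrangian s U)
    (huU : u ∈ U) (hu0 : u ≠ 0) (huP : ∀ x ∈ P, s x u = 0) :
    p ∣ Nat.card {W : Submodule F V // IsLagrangian s W ∧ P ≤ W ∧ W ⊓ U = ⊥} := by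
  classical
  set T := {W : Submodule F V // IsLagrangian s W ∧ P ≤ W ∧ W ⊓ U = ⊥}
  have := Fintype.ofFinite T
  have hu : s u u = 0 := (hU u).1 huU u huU
  have hmapU (c : ℤ) {x : V} (hx : skewTransvection s u c x ∈ U) : x ∈ U := by
    rw [skewTransvection_apply] at hx
    exact (U.add_mem_iff_left (U.smul_mem _ huU)).1 hx
  let f (c : ℤ) : T → T := fun W ↦ ⟨W.1.map (skewTransvection s u c),
    W.2.1.map_skewTransvection hs hu c, fun x hx ↦ ⟨x, W.2.2.1 hx, by
      rw [skewTransvection_apply, huP x hx, mul_zero, zero_smul, add_zero]⟩, by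
    rw [Submodule.eq_bot_iff]
    rintro _ ⟨⟨x, hx, rfl⟩, hxU⟩
    have : x ∈ W.1 ⊓ U := ⟨hx, hmapU c hxU⟩
    rw [W.2.2.2, Submodule.mem_bot] at this
    rw [this, map_zero]⟩
  have hf (n : ℕ) : (f 1)^[n] = f n := by
    induction n with
    | zero =>
      funext W
      apply Subtype.ext
      simp [f, skewTransvection_zero]
    | succ n ih =>
      rw [Function.iterate_succ', ih]
      funext W
      apply Subtype.ext
      simp only [Function.comp_apply, f]
      rw [← Submodule.map_comp, skewTransvection_comp hu]
      push_cast
      rw [add_comm]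
  let g : Function.End T := f 1
  have hfp : g ^ p ^ 1 = 1 := by
    rw [pow_one]
    change (f 1)^[p] = id
    rw [hf]
    funext W
    apply Subtype.ext
    have : skewTransvection s u (p : ℤ) = LinearMap.id := by
      ext x
      simp [skewTransvection_apply]
    simp [f, this]
  have hmod := Equiv.Perm.card_fixedPoints_modEq hfp
  have hempty : IsEmpty (Function.fixedPoints g) := by
    constructor
    rintro ⟨W, hW⟩
    have hW' : W.1.map (skewTransvection s u 1) = W.1 := congrArg Subtype.val hW
    have hbot {x : V} (h1 : x ∈ W.1) (h2 : x ∈ U) : x = 0 := by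
      have : x ∈ W.1 ⊓ U := ⟨h1, h2⟩
      rwa [W.2.2.2, Submodule.mem_bot] at this
    refine hu0 (hbot ((W.2.1 u).2 fun x hx ↦ ?_) huU)
    by_contra hne
    have hne' : s x u ≠ 0 := by
      intro h
      apply hne
      rw [hs x u, h, map_zero, neg_zero]
    have h1 : x + s x u • u ∈ W.1 := by
      rw [← hW']
      exact ⟨x, hx, by simp [skewTransvection_apply]⟩
    exact hu0 (hbot ((W.1.smul_mem_iff hne').1 ((W.1.add_mem_iff_right hx).1 h1)) huU)
  rw [Fintype.card_eq_zero (α := Function.fixedPoints g)] at hmod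
  rw [Nat.card_eq_fintype_card]
  exact (Nat.modEq_zero_iff_dvd).1 hmod

/-- The oppositeness matrix of Lagrangian subspaces. -/
noncomputable def lagrangianOpposite (k : Type*) [Field k] (s : V →ₗ[F] V →ₛₗ[σ] F) :
    Matrix {W : Submodule F V // IsLagrangian s W} {W : Submodule F V // IsLagrangian s W} k :=
  open Classical in fun U W ↦ if U.1 ⊓ W.1 = ⊥ then 1 else 0

theorem lagrangianOpposite_isSymm (k : Type*) [Field k] : (lagrangianOpposite k s).IsSymm := by
  ext U W
  simp [lagrangianOpposite, inf_comm]

/-- The rows of the oppositeness matrix indexed by the Lagrangian subspaces opposite to a given one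
span all rows. -/
theorem lagrangianOpposite_mem_span [Finite V] (p : ℕ) [Fact p.Prime] [CharP F p]
    {k : Type*} [Field k] [CharP k p]
    (hs : ∀ x y, s y x = -σ (s x y)) (hnd : ∀ x, (∀ y, s x y = 0) → x = 0)
    (hdim : ∀ W, IsLagrangian s W → 2 * Module.finrank F W = Module.finrank F V)
    (E : Submodule F V) (hE : IsLagrangian s E) (W : {W : Submodule F V // IsLagrangian s W}) :
    (lagrangianOpposite k s).row W ∈ Submodule.span k
      (Set.range fun Y : {Y : {W : Submodule F V // IsLagrangian s W} // Y.1 ⊓ E = ⊥} ↦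
        (lagrangianOpposite k s).row Y.1) := by
  classical
  have := Fintype.ofFinite {W : Submodule F V // IsLagrangian s W}
  have : FiniteDimensional F V := Module.Finite.of_finite
  induction hn : Module.finrank F (W.1 ⊓ E : Submodule F V) using Nat.strong_induction_on
    generalizing W with
  | _ n ih =>
  by_cases hbot : W.1 ⊓ E = ⊥
  · exact Submodule.subset_span ⟨⟨W, hbot⟩, rfl⟩
  obtain ⟨e, ⟨heW, heE⟩, he0⟩ := Submodule.exists_mem_ne_zero_of_ne_bot hbot
  obtain ⟨z, hz⟩ : ∃ z, s e z ≠ 0 := by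
    by_contra! h
    exact he0 (hnd e h)
  set P : Submodule F V := W.1 ⊓ LinearMap.ker (s.flip z)
  have hzW : z ∉ W.1 := fun h ↦ hz ((W.2 e).1 heW z h)
  have hdecomp (x : V) (hx : x ∈ W.1) : x - (s x z / s e z) • e ∈ P := by
    refine ⟨W.1.sub_mem hx (W.1.smul_mem _ heW), ?_⟩
    simp [div_mul_cancel₀ _ hz]
  have hsum : ∑ Y with P ≤ Y.1, (lagrangianOpposite k s).row Y = 0 := by
    funext U
    obtain ⟨u, hu, hu0⟩ : ∃ u ∈ U.1 ⊓ (W.1 ⊔ Submodule.span F {z}), u ≠ 0 := by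
      apply Submodule.exists_mem_ne_zero_of_ne_bot
      intro h
      have h1 := Submodule.finrank_sup_add_finrank_inf_eq U.1 (W.1 ⊔ Submodule.span F {z})
      have h2 := Submodule.finrank_sup_add_finrank_inf_eq W.1 (Submodule.span F {z})
      have h3 : W.1 ⊓ Submodule.span F {z} = ⊥ := by
        rw [← disjoint_iff]
        exact (Submodule.disjoint_span_singleton_of_notMem hzW)
      have h4 : Module.finrank F (Submodule.span F {z}) = 1 :=
        finrank_span_singleton (fun h ↦ hzW (h ▸ W.1.zero_mem))
      have h5 := Submodule.finrank_le (U.1 ⊔ (W.1 ⊔ Submodule.span F {z}))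
      have h6 := hdim _ U.2
      have h7 := hdim _ W.2
      rw [h, finrank_bot] at h1
      rw [h3, finrank_bot] at h2
      omega
    have huP : ∀ x ∈ P, s x u = 0 := by
      rintro x ⟨hxW, hxz⟩
      obtain ⟨w, hw, v, hv, rfl⟩ := Submodule.mem_sup.1 hu.2
      obtain ⟨c, rfl⟩ := Submodule.mem_span_singleton.1 hv
      have hxz' : s x z = 0 := hxz
      rw [map_add, map_smulₛₗ, (W.2 x).1 hxW w hw, hxz', smul_zero, add_zero]
    have hdvd := dvd_card_isLagrangian_of_orthogonal p hs U.2 hu.1 hu0 huP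
    rw [← CharP.cast_eq_zero_iff k p] at hdvd
    rw [Finset.sum_apply, Pi.zero_apply, ← hdvd]
    simp only [Matrix.row, lagrangianOpposite]
    rw [Finset.sum_boole, Finset.filter_filter, ← Fintype.card_subtype, ← Nat.card_eq_fintype_card]
    congr 1
    exact Nat.card_congr (Equiv.subtypeSubtypeEquivSubtypeInter _
      fun Y : Submodule F V ↦ P ≤ Y ∧ Y ⊓ U.1 = ⊥)
  have hWmem : W ∈ ({Y | P ≤ Y.1} : Finset {W : Submodule F V // IsLagrangian s W}) := by
    simp [P]
  rw [← Finset.add_sum_erase _ _ hWmem, add_eq_zero_iff_eq_neg] at hsum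
  rw [hsum]
  refine Submodule.neg_mem _ (Submodule.sum_mem _ fun Y hY ↦ ?_)
  obtain ⟨hYW, hPY⟩ : Y ≠ W ∧ P ≤ Y.1 := by simpa using hY
  refine ih _ ?_ Y rfl
  rw [← hn]
  apply Submodule.finrank_lt_finrank_of_lt
  have key : Y.1 ⊓ E ≤ P := by
    rintro y ⟨hyY, hyE⟩
    by_contra hyP
    apply hYW
    have hyW : y ∈ W.1 := by
      rw [W.2]
      intro x hx
      have h1 : s y (x - (s x z / s e z) • e) = 0 := (Y.2 y).1 hyY _ (hPY (hdecomp x hx))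
      rwa [map_sub, map_smulₛₗ, (hE y).1 hyE e heE, smul_zero, sub_zero] at h1
    have hyz : s y z ≠ 0 := fun h ↦ hyP ⟨hyW, h⟩
    have heY : e ∈ Y.1 := by
      have h1 : (s y z / s e z) • e ∈ Y.1 := by
        simpa using Y.1.sub_mem hyY (hPY (hdecomp y hyW))
      exact (Y.1.smul_mem_iff (div_ne_zero hyz hz)).1 h1
    have hWY : W.1 ≤ Y.1 := fun x hx ↦ by
      simpa using Y.1.add_mem (hPY (hdecomp x hx)) (Y.1.smul_mem (s x z / s e z) heY)
    apply Subtype.ext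
    exact le_antisymm (fun y hy ↦ (W.2 y).2 fun x hx ↦ (Y.2 y).1 hy x (hWY hx)) hWY
  refine lt_of_le_of_ne (fun y hy ↦ ⟨(key hy).1, hy.2⟩) fun h ↦ hz ?_
  have heY : e ∈ Y.1 ⊓ E := by rw [h]; exact ⟨heW, heE⟩
  exact (key heY).2

end SkewHermitian

section HermitianForm

variable {F : Type*} [Field F] {σ : F →+* F}

/-- The scalar multiple by `κ` of the standard Hermitian form. -/
def scaledHermitianForm (σ : F →+* F) (κ : F) (n : ℕ) : (Fin n → F) →ₗ[F] (Fin n → F) →ₛₗ[σ] F :=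
  LinearMap.mk₂'ₛₗ (RingHom.id F) σ (fun x y ↦ κ * ∑ i, x i * σ (y i))
    (fun x x' y ↦ by simp only [Pi.add_apply, add_mul, Finset.sum_add_distrib, mul_add])
    (fun c x y ↦ by
      simp only [Pi.smul_apply, smul_eq_mul, RingHom.id_apply, Finset.mul_sum]
      exact Finset.sum_congr rfl fun i _ ↦ by ring)
    (fun x y y' ↦ by simp only [Pi.add_apply, map_add, mul_add, Finset.sum_add_distrib])
    (fun c x y ↦ by
      simp only [Pi.smul_apply, smul_eq_mul, map_mul, Finset.mul_sum]
      exact Finset.sum_congr rfl fun i _ ↦ by ring)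

theorem scaledHermitianForm_apply (κ : F) {n : ℕ} (x y : Fin n → F) :
    scaledHermitianForm σ κ n x y = κ * ∑ i, x i * σ (y i) := rfl

theorem scaledHermitianForm_skew (hσ : ∀ x, σ (σ x) = x) {κ : F} (hκ : σ κ = -κ) {n : ℕ}
    (x y : Fin n → F) :
    scaledHermitianForm σ κ n y x = -σ (scaledHermitianForm σ κ n x y) := by
  simp only [scaledHermitianForm_apply, map_mul, map_sum, hσ, hκ, neg_mul, neg_neg]
  exact congrArg _ (Finset.sum_congr rfl fun i _ ↦ mul_comm _ _)

theorem eq_zero_of_scaledHermitianForm_eq_zero {κ : F} (hκ : κ ≠ 0) {n : ℕ} (x : Fin n → F)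
    (hx : ∀ y, scaledHermitianForm σ κ n x y = 0) : x = 0 := by
  classical
  funext i
  simpa [scaledHermitianForm_apply, Pi.single_apply, apply_ite σ, hκ] using hx (Pi.single i 1)

/-- The orthogonal complement with respect to the standard Hermitian form. -/
def hermitianOrthogonal (σ : F →+* F) {n : ℕ} (W : Submodule F (Fin n → F)) :
    Submodule F (Fin n → F) where
  carrier := {x | ∀ y ∈ W, ∑ i, x i * σ (y i) = 0}
  add_mem' hx hx' y hy := by
    simp only [Pi.add_apply, add_mul, Finset.sum_add_distrib, hx y hy, hx' y hy, add_zero]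
  zero_mem' y _ := by simp
  smul_mem' c x hx y hy := by
    simp only [Pi.smul_apply, smul_eq_mul, mul_assoc, ← Finset.mul_sum, hx y hy, mul_zero]

theorem finrank_hermitianOrthogonal {n : ℕ} (W : Submodule F (Fin n → F)) :
    Module.finrank F W + Module.finrank F (hermitianOrthogonal σ W) = n := by
  let b := Module.finBasis F W
  let M : Matrix (Fin (Module.finrank F W)) (Fin n) F := Matrix.of fun j i ↦ (b j : Fin n → F) i
  have hM : M.rank = Module.finrank F W := by
    have : LinearIndependent F M.row :=
      b.linearIndependent.map' W.subtype W.ker_subtype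
    rw [this.rank_matrix, Fintype.card_fin]
  have hker : LinearMap.ker (M.map σ).mulVecLin = hermitianOrthogonal σ W := by
    ext x
    rw [LinearMap.mem_ker, Matrix.mulVecLin_apply]
    constructor
    · intro hx y hy
      have hx' (j) : ∑ i, x i * σ ((b j : Fin n → F) i) = 0 := by
        refine Eq.trans ?_ (congrFun hx j)
        exact Finset.sum_congr rfl fun i _ ↦ mul_comm _ _
      have hy' : y = ∑ j, b.repr ⟨y, hy⟩ j • (b j : Fin n → F) := by
        have := congrArg W.subtype (b.sum_repr ⟨y, hy⟩)
        rw [map_sum] at this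
        simp only [map_smul] at this
        exact this.symm
      rw [hy']
      simp only [Finset.sum_apply, Pi.smul_apply, smul_eq_mul, map_sum, map_mul, Finset.mul_sum]
      rw [Finset.sum_comm]
      refine Finset.sum_eq_zero fun j _ ↦ ?_
      rw [← mul_zero (σ (b.repr ⟨y, hy⟩ j)), ← hx' j, Finset.mul_sum]
      exact Finset.sum_congr rfl fun i _ ↦ by ring
    · intro hx
      funext j
      rw [Pi.zero_apply, ← hx (b j) (b j).2]
      simp only [Matrix.mulVec, dotProduct, M, Matrix.map_apply, Matrix.of_apply, mul_comm (σ _)]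
  have := (M.map σ).mulVecLin.finrank_range_add_finrank_ker
  rwa [hker, Module.finrank_fin_fun, ← Matrix.rank, Matrix.rank_map_ringHom, hM] at this

theorem isLagrangian_scaledHermitianForm_iff {κ : F} (hκ : κ ≠ 0) {d : ℕ}
    (W : Submodule F (Fin (2 * d) → F)) :
    IsLagrangian (scaledHermitianForm σ κ (2 * d)) W ↔
      Module.finrank F W = d ∧ ∀ x ∈ W, ∀ y ∈ W, ∑ i, x i * σ (y i) = 0 := by
  have hW : IsLagrangian (scaledHermitianForm σ κ (2 * d)) W ↔ W = hermitianOrthogonal σ W := by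
    simp [IsLagrangian, SetLike.ext_iff, scaledHermitianForm_apply, hκ, hermitianOrthogonal]
  have hfin := finrank_hermitianOrthogonal (σ := σ) W
  rw [hW]
  constructor
  · intro h
    refine ⟨?_, fun x hx ↦ ?_⟩
    · rw [← h] at hfin
      omega
    · rw [h] at hx
      exact hx
  · rintro ⟨hd, h⟩
    exact Submodule.eq_of_le_of_finrank_eq h (by omega)

end HermitianForm

section Hyperbolic

variable {F : Type*} [Field F] {σ : F →+* F}

/-- The Hermitian space of dimension `2 * d` has coordinates in which the form is hyperbolic. -/
theorem exists_hyperbolic_equiv (hσ : ∀ x, σ (σ x) = x) {κ ε ω : F} (hκ : σ κ = -κ) (hκ0 : κ ≠ 0)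
    (hε : ε * σ ε = -1) (hω : ω * σ ω = 1) (hω1 : ω ≠ 1) (d : ℕ) :
    ∃ Φ : ((Fin d → F) × (Fin d → F)) ≃ₗ[F] (Fin (2 * d) → F), ∀ x y,
      scaledHermitianForm σ κ (2 * d) (Φ x) (Φ y) =
        ∑ i, (x.1 i * σ (y.2 i) - x.2 i * σ (y.1 i)) := by
  classical
  have hσω : σ ω ≠ 1 := fun h ↦ hω1 (by rw [← hσ ω, h, map_one])
  have hne : κ * (1 - σ ω) ≠ 0 := mul_ne_zero hκ0 (sub_ne_zero.2 hσω.symm)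
  set μ := σ (κ * (1 - σ ω))⁻¹ with hμ
  have h1 : κ * (1 - σ ω) * σ μ = 1 := by rw [hμ, hσ, mul_inv_cancel₀ hne]
  have h2 : κ * (1 - ω) * μ = -1 := by
    have := congrArg σ h1
    simp only [map_mul, map_sub, map_one, hσ, hκ] at this
    linear_combination -this
  let e : Fin 2 → F := ![1, ε]
  let f : Fin 2 → F := ![μ, μ * (ε * ω)]
  let Φ : ((Fin d → F) × (Fin d → F)) →ₗ[F] (Fin (2 * d) → F) :=
    { toFun x k := x.1 (finProdFinEquiv.symm k).2 * e (finProdFinEquiv.symm k).1 +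
        x.2 (finProdFinEquiv.symm k).2 * f (finProdFinEquiv.symm k).1
      map_add' x y := by
        funext k
        simp only [Prod.fst_add, Prod.snd_add, Pi.add_apply]
        ring
      map_smul' c x := by
        funext k
        simp only [Prod.smul_fst, Prod.smul_snd, Pi.smul_apply, smul_eq_mul, RingHom.id_apply]
        ring }
  have hΦ (x y) : scaledHermitianForm σ κ (2 * d) (Φ x) (Φ y) =
      ∑ i, (x.1 i * σ (y.2 i) - x.2 i * σ (y.1 i)) := by
    rw [scaledHermitianForm_apply, ← finProdFinEquiv.sum_comp, Fintype.sum_prod_type_right,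
      Finset.mul_sum]
    refine Finset.sum_congr rfl fun i _ ↦ ?_
    simp only [Fin.sum_univ_two, Φ, e, f, LinearMap.coe_mk, AddHom.coe_mk, Equiv.symm_apply_apply,
      Matrix.cons_val_zero, Matrix.cons_val_one, map_add, map_mul, map_one]
    linear_combination (κ * x.1 i * σ (y.1 i) + κ * x.1 i * σ (y.2 i) * σ μ * σ ω +
        κ * x.2 i * σ (y.1 i) * μ * ω + κ * x.2 i * σ (y.2 i) * μ * σ μ * ω * σ ω) * hε
      - (κ * x.2 i * σ (y.2 i) * μ * σ μ) * hω
      + x.1 i * σ (y.2 i) * h1 + x.2 i * σ (y.1 i) * h2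
  have hinj : Function.Injective Φ := by
    rw [← LinearMap.ker_eq_bot, LinearMap.ker_eq_bot']
    intro x hx
    have h (y : (Fin d → F) × (Fin d → F)) : ∑ i, (x.1 i * σ (y.2 i) - x.2 i * σ (y.1 i)) = 0 := by
      rw [← hΦ, hx, map_zero, LinearMap.zero_apply]
    refine Prod.ext (funext fun i ↦ ?_) (funext fun i ↦ ?_)
    · simpa [Pi.single_apply, apply_ite σ] using h (0, Pi.single i 1)
    · simpa [Pi.single_apply, apply_ite σ] using h (Pi.single i 1, 0)
  refine ⟨LinearEquiv.ofInjectiveOfFinrankEq Φ hinj ?_, hΦ⟩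
  simp [two_mul]

variable {V : Type*} [AddCommGroup V] [Module F V] {s : V →ₗ[F] V →ₛₗ[σ] F} {d : ℕ}
  (Φ : ((Fin d → F) × (Fin d → F)) ≃ₗ[F] V)

/-- The graph of a matrix, in coordinates given by `Φ`. -/
def graphSubspace (X : Matrix (Fin d) (Fin d) F) : Submodule F V :=
  LinearMap.range (Φ.toLinearMap ∘ₗ LinearMap.prod LinearMap.id X.mulVecLin)

variable {Φ}

theorem mem_graphSubspace {X : Matrix (Fin d) (Fin d) F} {x} :
    Φ x ∈ graphSubspace Φ X ↔ x.2 = X.mulVec x.1 := by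
  constructor
  · rintro ⟨a, h⟩
    rw [← Φ.injective h]
    rfl
  · exact fun h ↦ ⟨x.1, congrArg Φ (Prod.ext rfl h.symm)⟩

theorem graphSubspace_inf_eq_bot_iff {X Y : Matrix (Fin d) (Fin d) F} :
    graphSubspace Φ X ⊓ graphSubspace Φ Y = ⊥ ↔ (X - Y).det ≠ 0 := by
  rw [← not_iff_not, not_not, ← Matrix.exists_mulVec_eq_zero_iff, ← ne_eq, Submodule.ne_bot_iff]
  constructor
  · rintro ⟨v, hv, hv0⟩
    obtain ⟨x, rfl⟩ := Φ.surjective v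
    obtain ⟨hX, hY⟩ := hv
    rw [SetLike.mem_coe, mem_graphSubspace] at hX hY
    refine ⟨x.1, fun h ↦ hv0 ?_, by rw [Matrix.sub_mulVec, ← hX, ← hY, sub_self]⟩
    rw [show x = 0 from Prod.ext h (by rw [hX, h, Matrix.mulVec_zero]; rfl), map_zero]
  · rintro ⟨a, ha, hXY⟩
    rw [Matrix.sub_mulVec, sub_eq_zero] at hXY
    refine ⟨Φ (a, X.mulVec a), ⟨mem_graphSubspace.2 rfl, mem_graphSubspace.2 hXY⟩, fun h ↦ ha ?_⟩
    exact congrArg Prod.fst ((Φ.map_eq_zero_iff).1 h)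

theorem isLagrangian_graphSubspace
    (hΦ : ∀ x y, s (Φ x) (Φ y) = ∑ i, (x.1 i * σ (y.2 i) - x.2 i * σ (y.1 i)))
    {X : Matrix (Fin d) (Fin d) F} (hX : ∀ i j, X j i = σ (X i j)) :
    IsLagrangian s (graphSubspace Φ X) := by
  classical
  have key (x : (Fin d → F) × (Fin d → F)) (a : Fin d → F) :
      s (Φ x) (Φ (a, X.mulVec a)) = ∑ i, (X.mulVec x.1 i - x.2 i) * σ (a i) := by
    simp only [hΦ, sub_mul, Finset.sum_sub_distrib, Matrix.mulVec, dotProduct, map_sum, map_mul,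
      ← hX, Finset.mul_sum, Finset.sum_mul]
    rw [Finset.sum_comm]
    exact congrArg (· - _) (Finset.sum_congr rfl fun i _ ↦ Finset.sum_congr rfl fun j _ ↦ by ring)
  intro v
  obtain ⟨x, rfl⟩ := Φ.surjective v
  rw [mem_graphSubspace]
  constructor
  · rintro h _ ⟨a, rfl⟩
    refine (key x a).trans (Finset.sum_eq_zero fun i _ ↦ ?_)
    rw [h, sub_self, zero_mul]
  · intro h
    funext i
    have := (key x (Pi.single i 1)).symm.trans (h _ (mem_graphSubspace.2 rfl))
    exact (sub_eq_zero.1 (by simpa [Pi.single_apply, apply_ite σ] using this)).symm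

theorem isLagrangian_map_inr
    (hΦ : ∀ x y, s (Φ x) (Φ y) = ∑ i, (x.1 i * σ (y.2 i) - x.2 i * σ (y.1 i))) :
    IsLagrangian s
      (LinearMap.range (Φ.toLinearMap ∘ₗ LinearMap.inr F (Fin d → F) (Fin d → F))) := by
  classical
  intro v
  obtain ⟨x, rfl⟩ := Φ.surjective v
  constructor
  · rintro ⟨b, hb⟩ _ ⟨b', rfl⟩
    rw [← Φ.injective hb]
    exact (hΦ _ _).trans (by simp)
  · intro h
    refine ⟨x.2, congrArg Φ (Prod.ext (funext fun i ↦ ?_) rfl)⟩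
    have := (hΦ _ _).symm.trans (h _ ⟨Pi.single i 1, rfl⟩)
    simpa [Pi.single_apply, apply_ite σ, eq_comm] using this

/-- The Lagrangian subspaces opposite to the second coordinate subspace are the graphs of Hermitian
matrices. -/
theorem exists_graphSubspace_eq
    (hΦ : ∀ x y, s (Φ x) (Φ y) = ∑ i, (x.1 i * σ (y.2 i) - x.2 i * σ (y.1 i)))
    {W : Submodule F V} (hW : IsLagrangian s W) (hd : Module.finrank F W = d)
    (hWE : W ⊓ LinearMap.range (Φ.toLinearMap ∘ₗ LinearMap.inr F (Fin d → F) (Fin d → F)) = ⊥) :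
    ∃ X : Matrix (Fin d) (Fin d) F, (∀ i j, X j i = σ (X i j)) ∧ graphSubspace Φ X = W := by
  classical
  have : FiniteDimensional F V := Φ.finiteDimensional
  let π : W →ₗ[F] (Fin d → F) := LinearMap.fst F _ _ ∘ₗ Φ.symm.toLinearMap ∘ₗ W.subtype
  have hπ : Function.Injective π := by
    rw [← LinearMap.ker_eq_bot, LinearMap.ker_eq_bot']
    intro w hw
    have : w.1 ∈ W ⊓
        LinearMap.range (Φ.toLinearMap ∘ₗ LinearMap.inr F (Fin d → F) (Fin d → F)) := by
      refine ⟨w.2, (Φ.symm w.1).2, ?_⟩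
      rw [← Φ.apply_symm_apply w.1]
      exact congrArg Φ (Prod.ext hw.symm (by rw [Φ.apply_symm_apply]; rfl))
    rw [hWE, Submodule.mem_bot] at this
    exact Subtype.ext this
  let π' := LinearEquiv.ofInjectiveOfFinrankEq π hπ (by simp [hd])
  let X := LinearMap.toMatrix' (LinearMap.snd F _ _ ∘ₗ Φ.symm.toLinearMap ∘ₗ W.subtype ∘ₗ
    π'.symm.toLinearMap)
  have hmem (a : Fin d → F) : Φ (a, X.mulVec a) ∈ W := by
    have h : (a, X.mulVec a) = Φ.symm (π'.symm a) :=
      Prod.ext (π'.apply_symm_apply a).symm (LinearMap.toMatrix'_mulVec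
        (LinearMap.snd F _ _ ∘ₗ Φ.symm.toLinearMap ∘ₗ W.subtype ∘ₗ π'.symm.toLinearMap) a)
    rw [h, Φ.apply_symm_apply]
    exact (π'.symm a).2
  have hX (i j) : X j i = σ (X i j) := by
    have := (hΦ _ _).symm.trans ((hW _).1 (hmem (Pi.single i 1)) _ (hmem (Pi.single j 1)))
    exact (sub_eq_zero.1 (by simpa [Pi.single_apply, apply_ite σ] using this)).symm
  have hle : graphSubspace Φ X ≤ W := by
    rintro _ ⟨a, rfl⟩
    exact hmem a
  exact ⟨X, hX, hle.antisymm fun w hw ↦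
    (isLagrangian_graphSubspace hΦ hX w).2 fun y hy ↦ (hW w).1 hw y (hle hy)⟩

end Hyperbolic

open MvPolynomial in
/-- A polynomial in two blocks of variables, of degree less than `p` in each variable, is given by
a matrix of coefficients indexed by pairs of reduced monomials. -/
theorem MvPolynomial.aeval_sumElim_eq_sum {k ι : Type*} [Field k] [Fintype ι] [DecidableEq ι]
    {p : ℕ}
    (P : MvPolynomial (ι ⊕ ι) k) (hP : ∀ v, P.degreeOf v < p) {R : Type*} [CommRing R]
    [Algebra k R] (x y : ι → R) :
    aeval (Sum.elim x y) P = ∑ m : ι → Fin p, ∑ n : ι → Fin p, (∏ i, x i ^ (m i : ℕ)) *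
      algebraMap k R (P.coeff (Finsupp.equivFunOnFinite.symm
        (Sum.elim (fun i ↦ (m i : ℕ)) fun i ↦ (n i : ℕ)))) * ∏ i, y i ^ (n i : ℕ) := by
  classical
  let φ : (ι → Fin p) × (ι → Fin p) → (ι ⊕ ι →₀ ℕ) := fun mn ↦ Finsupp.equivFunOnFinite.symm
        (Sum.elim (fun i ↦ (mn.1 i : ℕ)) fun i ↦ (mn.2 i : ℕ))
  have hφ : Function.Injective φ := by
    rintro ⟨m, n⟩ ⟨m', n'⟩ h
    have h' := Finsupp.equivFunOnFinite.symm.injective h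
    rw [Prod.mk.injEq]
    constructor
    · funext i
      exact Fin.ext (congrFun h' (Sum.inl i))
    · funext i
      exact Fin.ext (congrFun h' (Sum.inr i))
  have hsub : P.support ⊆ Finset.univ.image φ := by
    intro a ha
    have hlt (v : ι ⊕ ι) : a v < p :=
      (degreeOf_lt_iff ((Nat.zero_le _).trans_lt (hP v))).1 (hP v) a ha
    refine Finset.mem_image.2 ⟨(fun i ↦ ⟨a (Sum.inl i), hlt _⟩, fun i ↦ ⟨a (Sum.inr i), hlt _⟩),
      Finset.mem_univ _, ?_⟩
    ext v
    cases v <;> rfl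
  rw [aeval_eq_eval₂Hom, coe_eval₂Hom, eval₂_eq, Finset.sum_subset hsub,
    Finset.sum_image hφ.injOn, ← Finset.univ_product_univ, Finset.sum_product]
  · refine Finset.sum_congr rfl fun m _ ↦ Finset.sum_congr rfl fun n _ ↦ ?_
    have : ∏ i ∈ (φ (m, n)).support, Sum.elim x y i ^ (φ (m, n)) i =
        (∏ i, x i ^ (m i : ℕ)) * ∏ i, y i ^ (n i : ℕ) := by
      rw [Finset.prod_subset (Finset.subset_univ _), Fintype.prod_sum_type]
      · simp [φ]
      · intro v _ hv
        rw [Finsupp.notMem_support_iff.1 hv, pow_zero]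
    rw [this]
    ring
  · intro a _ ha
    rw [notMem_support_iff.1 ha, map_zero, zero_mul]

open MvPolynomial in
/-- The polynomial `det (X - Y) ^ (p - 1)` is given by a matrix of coefficients indexed by pairs of
reduced monomials. -/
theorem exists_det_sub_pow_eq_sum (p d : ℕ) [Fact p.Prime] :
    ∃ C : Matrix (Fin d × Fin d → Fin p) (Fin d × Fin d → Fin p) (ZMod p),
      ∀ (R : Type) [CommRing R] [Algebra (ZMod p) R] (X Y : Matrix (Fin d) (Fin d) R),
        (X - Y).det ^ (p - 1) = ∑ m, ∑ n, (∏ i, X i.1 i.2 ^ (m i : ℕ)) *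
          algebraMap (ZMod p) R (C m n) * ∏ i, Y i.1 i.2 ^ (n i : ℕ) := by
  classical
  let M : Matrix (Fin d) (Fin d) (MvPolynomial (Fin d × Fin d ⊕ Fin d × Fin d) (ZMod p)) :=
    Matrix.of fun i j ↦ X (Sum.inl (i, j)) - X (Sum.inr (i, j))
  have hM (i j : Fin d) (v) : (M i j).degreeOf v ≤ if v.elim id id = (i, j) then 1 else 0 := by
    refine (degreeOf_sub_le _ _ _).trans ?_
    rw [degreeOf_X, degreeOf_X]
    rcases v with v | v <;> simp <;> split_ifs <;> simp_all
  have hdet (v) : M.det.degreeOf v ≤ 1 := by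
    rw [Matrix.det_apply]
    refine (degreeOf_sum_le _ _ _).trans (Finset.sup_le fun π _ ↦ ?_)
    have h1 : (∏ i, M (π i) i).degreeOf v ≤ 1 := by
      refine (degreeOf_prod_le _ _ _).trans ((Finset.sum_le_sum fun i _ ↦ hM _ _ v).trans ?_)
      calc ∑ i, (if v.elim id id = (π i, i) then 1 else 0)
          ≤ ∑ i, if (v.elim id id).2 = i then 1 else 0 := by
            refine Finset.sum_le_sum fun i _ ↦ ?_
            by_cases h : v.elim id id = (π i, i)
            · simp [h]
            · rw [if_neg h]
              exact Nat.zero_le _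
        _ = 1 := by simp
    rcases Int.units_eq_one_or (Equiv.Perm.sign π) with h | h
    · rwa [h, one_smul]
    · rwa [h, Units.neg_smul, one_smul, degreeOf_neg]
  have hdeg (v) : (M.det ^ (p - 1)).degreeOf v < p := by
    have h1 := degreeOf_pow_le v M.det (p - 1)
    have h2 := Nat.mul_le_mul_left (p - 1) (hdet v)
    have h3 := (Fact.out : p.Prime).pos
    omega
  refine ⟨fun m n ↦ (M.det ^ (p - 1)).coeff (Finsupp.equivFunOnFinite.symm
    (Sum.elim (fun i ↦ (m i : ℕ)) fun i ↦ (n i : ℕ))), fun R _ _ A B ↦ ?_⟩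
  rw [← aeval_sumElim_eq_sum _ hdeg (fun i ↦ A i.1 i.2) (fun i ↦ B i.1 i.2), map_pow,
    AlgHom.map_det]
  congr 2
  ext i j
  simp [M]

section Hermitian

variable {F : Type*} [Field F] [Fintype F]

open MvPolynomial in
/-- Monomials of degree less than `q` in each entry are linearly independent as functions on the
set of Hermitian matrices over a field with `q ^ 2` elements. -/
theorem eq_zero_of_sum_monomial_hermitian_eq_zero {d q : ℕ} (hq : q ^ 2 ≤ Fintype.card F)
    (hq2 : ∀ x : F, (x ^ q) ^ q = x)
    (hfix : q ≤ Nat.card {x : F // x ^ q = x}) {μ : Type*} [Fintype μ]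
    (a : μ → Fin d × Fin d → ℕ) (ha : Function.Injective a) (haq : ∀ m i, a m i < q)
    (c : μ → F)
    (h : ∀ X : Matrix (Fin d) (Fin d) F, (∀ i j, X j i = X i j ^ q) →
      ∑ m, c m * ∏ i, X i.1 i.2 ^ a m i = 0) : c = 0 := by
  classical
  let e : μ → (Fin d × Fin d →₀ ℕ) := fun m ↦ Finsupp.equivFunOnFinite.symm fun i ↦
    if i.1 < i.2 then a m i + q * a m i.swap else if i.1 = i.2 then a m i else 0
  have e_apply (m i) : e m i =
    if i.1 < i.2 then a m i + q * a m i.swap else if i.1 = i.2 then a m i else 0 := rfl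
  have he : Function.Injective e := by
    intro m n hmn
    apply ha
    have key (i : Fin d × Fin d) (hi : i.1 < i.2) : a m i = a n i ∧ a m i.swap = a n i.swap := by
      have h1 := DFunLike.congr_fun hmn i
      rw [e_apply, e_apply, if_pos hi, if_pos hi] at h1
      have hqpos : 0 < q := (Nat.zero_le _).trans_lt (haq m i)
      constructor
      · have := congrArg (· % q) h1
        simpa [Nat.add_mul_mod_self_left, Nat.mod_eq_of_lt (haq _ _)] using this
      · have := congrArg (· / q) h1
        simpa [Nat.add_mul_div_left _ _ hqpos, Nat.div_eq_of_lt (haq _ _)] using this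
    funext i
    rcases lt_trichotomy i.1 i.2 with hi | hi | hi
    · exact (key i hi).1
    · have h1 := DFunLike.congr_fun hmn i
      simpa [e_apply, hi] using h1
    · simpa using (key i.swap hi).2
  let Q : MvPolynomial (Fin d × Fin d) F := ∑ m, monomial (e m) (c m)
  let S : Fin d × Fin d → Finset F := fun i ↦
    if i.1 = i.2 then Finset.univ.filter fun x ↦ x ^ q = x else Finset.univ
  have hprod (z : Fin d × Fin d → F) (hz : ∀ i, z (i, i) ^ q = z (i, i)) (m : μ) :
      ∏ i, z i ^ e m i =
        ∏ i : Fin d × Fin d, (if i.1 ≤ i.2 then z i else z i.swap ^ q) ^ a m i := by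
    have h1 : ∏ i : Fin d × Fin d, (if i.1 ≤ i.2 then z i else z i.swap ^ q) ^ a m i =
        (∏ i : Fin d × Fin d, if i.1 ≤ i.2 then z i ^ a m i else 1) *
          ∏ i : Fin d × Fin d, if i.1 ≤ i.2 then 1 else z i.swap ^ (q * a m i) := by
      rw [← Finset.prod_mul_distrib]
      refine Finset.prod_congr rfl fun i _ ↦ ?_
      split_ifs
      · rw [mul_one]
      · rw [one_mul, pow_mul]
    rw [h1, ← (Equiv.prodComm (Fin d) (Fin d)).prod_comp
      (fun i ↦ if i.1 ≤ i.2 then 1 else z i.swap ^ (q * a m i)), ← Finset.prod_mul_distrib]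
    refine Finset.prod_congr rfl fun i _ ↦ ?_
    rw [e_apply]
    rcases lt_trichotomy i.1 i.2 with hi | hi | hi
    · simp [hi, hi.le, hi.not_ge, pow_add]
    · simp [hi]
    · simp [hi.not_ge, hi.not_gt, hi.ne', hi.le]
  have hQ : Q = 0 := by
    refine eq_zero_of_eval_zero_at_prod_finset Q S (fun i ↦ ?_) fun z hz ↦ ?_
    · have hS : (if i.1 = i.2 then q else q ^ 2) ≤ (S i).card := by
        by_cases hi : i.1 = i.2
        · simp only [S, if_pos hi]
          rwa [← Fintype.card_subtype, ← Nat.card_eq_fintype_card]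
        · rwa [if_neg hi, show S i = Finset.univ from if_neg hi, Finset.card_univ]
      refine lt_of_lt_of_le ?_ hS
      rcases isEmpty_or_nonempty μ with hμ | ⟨⟨m₀⟩⟩
      · have : 0 < q := by
          by_contra h0
          obtain rfl : q = 0 := by omega
          simpa using hq2 0
        simp only [Q, Finset.univ_eq_empty, Finset.sum_empty, degreeOf_zero]
        split_ifs <;> positivity
      have hqpos : 0 < q := (Nat.zero_le _).trans_lt (haq m₀ i)
      rw [degreeOf_lt_iff (by split_ifs <;> positivity)]
      intro b hb
      obtain ⟨m, -, hm⟩ := Finset.mem_biUnion.1 (support_sum hb)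
      rw [Finset.mem_singleton.1 (support_monomial_subset hm), e_apply]
      have h1 := haq m i
      have h2 := haq m i.swap
      rcases lt_trichotomy i.1 i.2 with hi | hi | hi
      · rw [if_pos hi, if_neg hi.ne]
        nlinarith
      · simpa [hi] using h1
      · rw [if_neg hi.not_gt, if_neg hi.ne', if_neg hi.ne']
        positivity
    · have hz' (i) : z (i, i) ^ q = z (i, i) := by
        simpa [S] using hz (i, i)
      simp only [Q, map_sum, eval_monomial]
      have := h (Matrix.of fun i j ↦ if i ≤ j then z (i, j) else z (j, i) ^ q) fun i j ↦ by
        rcases lt_trichotomy i j with hi | rfl | hi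
        · simp [hi.le, hi.not_ge]
        · simp [hz']
        · simp [hi.le, hi.not_ge, hq2]
      rw [← this]
      refine Finset.sum_congr rfl fun m _ ↦ ?_
      rw [Finsupp.prod_fintype _ _ (fun i ↦ pow_zero _), hprod z hz' m]
      rfl
  funext m
  have := congrArg (coeff (e m)) hQ
  simpa [Q, coeff_sum, coeff_monomial, he.eq_iff] using this

end Hermitian

theorem exists_pow_eq_of_pow_eq_one {G : Type*} [CommGroup G] [IsCyclic G] {a b : ℕ} (ha : 0 < a)
    (hG : Nat.card G = a * b) {z : G} (hz : z ^ a = 1) : ∃ y : G, y ^ b = z := by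
  obtain ⟨g, hg⟩ := IsCyclic.exists_generator (α := G)
  obtain ⟨n, rfl⟩ := Subgroup.mem_zpowers_iff.1 (hg z)
  rw [← zpow_natCast, ← zpow_mul, ← orderOf_dvd_iff_zpow_eq_one,
    orderOf_eq_card_of_forall_mem_zpowers hg, hG] at hz
  push_cast at hz
  rw [mul_comm (a : ℤ)] at hz
  obtain ⟨c, rfl⟩ := Int.dvd_of_mul_dvd_mul_right (by exact_mod_cast ha.ne') hz
  refine ⟨g ^ c, ?_⟩
  rw [← zpow_natCast, ← zpow_mul, mul_comm]

section QuadraticFiniteField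

variable {F : Type*} [Field F] [Fintype F] {q : ℕ}

theorem natCard_units_of_card_eq_sq (hF : Fintype.card F = q ^ 2) :
    Nat.card Fˣ = (q - 1) * (q + 1) := by
  rw [Nat.card_units, Nat.card_eq_fintype_card, hF, mul_comm, ← Nat.sq_sub_sq, one_pow]

theorem le_card_pow_eq_self (hF : Fintype.card F = q ^ 2) (hq : 2 ≤ q) :
    q ≤ Nat.card {x : F // x ^ q = x} := by
  have hker := IsCyclic.card_powMonoidHom_ker (G := Fˣ) (q - 1)
  rw [natCard_units_of_card_eq_sq hF, Nat.gcd_mul_right_left] at hker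
  let f : Option (powMonoidHom (q - 1) : Fˣ →* Fˣ).ker → {x : F // x ^ q = x} := fun u ↦
    match u with
    | none => ⟨0, zero_pow (by omega)⟩
    | some u => ⟨(u.1 : F), by
        have h : (u.1 : F) ^ (q - 1) = 1 := by
          have := u.2
          rw [MonoidHom.mem_ker, powMonoidHom_apply] at this
          rw [← Units.val_pow_eq_pow_val, this, Units.val_one]
        rw [← pow_sub_one_mul (by omega), h, one_mul]⟩
  have hf : Function.Injective f := by
    rintro (_ | u) (_ | v) h
    · rfl
    · exact absurd (congrArg Subtype.val h).symm v.1.ne_zero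
    · exact absurd (congrArg Subtype.val h) u.1.ne_zero
    · exact congrArg some (Subtype.ext (Units.ext (congrArg Subtype.val h)))
  have := Nat.card_le_card_of_injective f hf
  rw [Finite.card_option, hker] at this
  omega

theorem exists_ne_one_mul_pow_eq_one (hF : Fintype.card F = q ^ 2) (hq : 2 ≤ q) :
    ∃ x : F, x ≠ 1 ∧ x * x ^ q = 1 := by
  have hker := IsCyclic.card_powMonoidHom_ker (G := Fˣ) (q + 1)
  rw [natCard_units_of_card_eq_sq hF, Nat.gcd_mul_left_left] at hker
  have : Nontrivial (powMonoidHom (q + 1) : Fˣ →* Fˣ).ker :=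
    Finite.one_lt_card_iff_nontrivial.1 (by omega)
  obtain ⟨u, hu⟩ := exists_ne (1 : (powMonoidHom (q + 1) : Fˣ →* Fˣ).ker)
  refine ⟨(u.1 : F), fun h ↦ hu (Subtype.ext (Units.ext h)), ?_⟩
  have := u.2
  rw [MonoidHom.mem_ker, powMonoidHom_apply] at this
  rw [← pow_succ', ← Units.val_pow_eq_pow_val, this, Units.val_one]

theorem exists_mul_pow_eq_neg_one (hF : Fintype.card F = q ^ 2) (hq : 2 ≤ q)
    (hneg : (-1 : F) ^ q = -1) : ∃ x : F, x * x ^ q = -1 := by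
  obtain ⟨y, hy⟩ := exists_pow_eq_of_pow_eq_one (z := (-1 : Fˣ)) (by omega)
    (natCard_units_of_card_eq_sq hF) (by
      apply mul_right_cancel (b := (-1 : Fˣ))
      rw [← pow_succ, Nat.sub_add_cancel (by omega), one_mul]
      exact Units.ext (by simpa using hneg))
  refine ⟨y, ?_⟩
  rw [← pow_succ', ← Units.val_pow_eq_pow_val, hy, Units.val_neg, Units.val_one]

theorem exists_ne_zero_pow_eq_neg (hF : Fintype.card F = q ^ 2) (hq : 2 ≤ q)
    (hneg : (-1 : F) ^ q = -1) : ∃ x : F, x ≠ 0 ∧ x ^ q = -x := by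
  obtain ⟨y, hy⟩ := exists_pow_eq_of_pow_eq_one (z := (-1 : Fˣ)) (Nat.succ_pos q)
    ((natCard_units_of_card_eq_sq hF).trans (mul_comm _ _)) (Units.ext (by simp [pow_succ, hneg]))
  refine ⟨y, y.ne_zero, ?_⟩
  rw [← Nat.sub_add_cancel (show 1 ≤ q by omega), pow_succ, ← Units.val_pow_eq_pow_val, hy]
  simp

end QuadraticFiniteField

/-- Hermitian matrices with respect to `x ↦ x ^ q`. -/
abbrev HermitianMatrix (F : Type*) [Field F] (q d : ℕ) : Type _ :=
  {X : Matrix (Fin d) (Fin d) F // ∀ i j, X j i = X i j ^ q}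

theorem Matrix.exists_leftInverse_of_mulVec {F m n : Type*} [Field F] [Fintype m] [Fintype n]
    [DecidableEq n] (E : Matrix m n F) (hE : ∀ c, E.mulVec c = 0 → c = 0) :
    ∃ E' : Matrix n m F, E' * E = 1 := by
  classical
  obtain ⟨g, hg⟩ := LinearMap.exists_leftInverse_of_injective E.mulVecLin
    (LinearMap.ker_eq_bot'.2 hE)
  refine ⟨LinearMap.toMatrix' g, ?_⟩
  rw [← LinearMap.toMatrix'_id, ← hg, LinearMap.toMatrix'_comp, ← Matrix.toLin'_apply',
    LinearMap.toMatrix'_toLin']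

/-- The matrix `det (X - Y) ^ (p ^ t - 1)` indexed by Hermitian matrices has the rank of the `t`-th
tensor power of the coefficient matrix of `det (X - Y) ^ (p - 1)`. -/
theorem rank_det_sub_pow_hermitian {p t d : ℕ} [Fact p.Prime] (ht : 1 ≤ t)
    {C : Matrix (Fin d × Fin d → Fin p) (Fin d × Fin d → Fin p) (ZMod p)}
    {F : Type} [Field F] [Fintype F] [Algebra (ZMod p) F]
    [Fintype (HermitianMatrix F (p ^ t) d)] (hF : Fintype.card F = (p ^ t) ^ 2)
    (hC : ∀ X Y : Matrix (Fin d) (Fin d) F, (X - Y).det ^ (p - 1) =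
      ∑ m, ∑ n, (∏ i, X i.1 i.2 ^ (m i : ℕ)) *
          algebraMap (ZMod p) F (C m n) * ∏ i, Y i.1 i.2 ^ (n i : ℕ)) :
    (Matrix.of fun X Y : HermitianMatrix F (p ^ t) d ↦ (X.1 - Y.1).det ^ (p ^ t - 1)).rank =
      C.rank ^ t := by
  classical
  have : CharP F p := charP_of_injective_algebraMap (algebraMap (ZMod p) F).injective p
  have hp2 : 2 ≤ p := (Fact.out : p.Prime).two_le
  have hq2 : 2 ≤ p ^ t := hp2.trans (Nat.le_self_pow (by omega) p)
  let M (k : Fin t) : Matrix (HermitianMatrix F (p ^ t) d) (Fin d × Fin d → Fin p) F :=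
    Matrix.of fun X m ↦ ∏ i, (X.1 i.1 i.2 ^ p ^ (k : ℕ)) ^ (m i : ℕ)
  let E : Matrix (HermitianMatrix F (p ^ t) d) (Fin t → Fin d × Fin d → Fin p) F :=
    Matrix.of fun X m ↦ ∏ k, M k X (m k)
  have hpow (X Y : Matrix (Fin d) (Fin d) F) (k : ℕ) : ((X - Y).det ^ p ^ k) ^ (p - 1) =
      ∑ m, ∑ n, (∏ i, (X i.1 i.2 ^ p ^ k) ^ (m i : ℕ)) *
          algebraMap (ZMod p) F (C m n) * ∏ i, (Y i.1 i.2 ^ p ^ k) ^ (n i : ℕ) := by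
    rw [← iterateFrobenius_def (R := F) p, RingHom.map_det]
    have := hC (X.map (iterateFrobenius F p k)) (Y.map (iterateFrobenius F p k))
    simp only [Matrix.map_apply, iterateFrobenius_def] at this
    rw [← this]
    congr 2
    ext i j
    simp
  have hsum : p ^ t - 1 = ∑ k : Fin t, p ^ (k : ℕ) * (p - 1) := by
    rw [← Finset.sum_mul, Fin.sum_univ_eq_sum_range (fun k ↦ p ^ k), Nat.geomSum_eq hp2,
      Nat.div_mul_cancel (Nat.sub_one_dvd_pow_sub_one p t)]
  have hD : (Matrix.of fun X Y : HermitianMatrix F (p ^ t) d ↦ (X.1 - Y.1).det ^ (p ^ t - 1)) =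
      E * Matrix.tensorPow t (C.map (algebraMap (ZMod p) F)) * E.transpose := by
    ext X Y
    rw [Matrix.of_apply, hsum, ← Finset.prod_pow_eq_pow_sum]
    simp only [pow_mul, hpow, Matrix.mul_apply, Matrix.transpose_apply]
    simp only [Finset.prod_univ_sum, Fintype.piFinset_univ, Finset.sum_mul]
    rw [Finset.sum_comm]
    simp only [E, M, Matrix.tensorPow, Finset.prod_mul_distrib, Matrix.of_apply, Matrix.map_apply]
  obtain ⟨E', hE'⟩ := E.exists_leftInverse_of_mulVec fun c hc ↦ by
    refine eq_zero_of_sum_monomial_hermitian_eq_zero hF.ge (fun x ↦ ?_)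
      (le_card_pow_eq_self hF hq2)
      (fun (m : Fin t → Fin d × Fin d → Fin p) i ↦
        (finFunctionFinEquiv fun k ↦ m k i : Fin (p ^ t)).val)
      (fun m n hmn ↦ ?_) (fun m i ↦ Fin.is_lt _) c fun X hX ↦ ?_
    · rw [← pow_mul, ← sq, ← hF, FiniteField.pow_card]
    · funext k i
      have := finFunctionFinEquiv.injective (Fin.ext (congrFun hmn i))
      exact congrFun this k
    · refine Eq.trans ?_ (congrFun hc ⟨X, hX⟩)
      rw [Matrix.mulVec, dotProduct]
      refine Finset.sum_congr rfl fun m _ ↦ ?_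
      rw [mul_comm]
      congr 1
      simp only [E, M, Matrix.of_apply]
      rw [Finset.prod_comm]
      refine Finset.prod_congr rfl fun i _ ↦ ?_
      rw [finFunctionFinEquiv_apply, ← Finset.prod_pow_eq_pow_sum]
      refine Finset.prod_congr rfl fun k _ ↦ ?_
      rw [← pow_mul, mul_comm]
  rw [hD, Matrix.rank_mul_mul_of_inverses hE' (R' := E'.transpose), Matrix.rank_tensorPow,
    Matrix.rank_map_ringHom]
  rw [← Matrix.transpose_mul, hE', Matrix.transpose_one]

section OppositenessRank

variable {p t d : ℕ} [Fact p.Prime] {F : Type} [Field F] [Fintype F]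

theorem rank_lagrangianOpposite (ht : 1 ≤ t) (hF : Fintype.card F = (p ^ t) ^ 2) [CharP F p]
    {σ : F →+* F} (hσ : ∀ x, σ x = x ^ p ^ t) {κ : F} (hκ : σ κ = -κ) (hκ0 : κ ≠ 0)
    {C : Matrix (Fin d × Fin d → Fin p) (Fin d × Fin d → Fin p) (ZMod p)}
    (hC : ∀ (R : Type) [CommRing R] [Algebra (ZMod p) R] (X Y : Matrix (Fin d) (Fin d) R),
      (X - Y).det ^ (p - 1) = ∑ m, ∑ n, (∏ i, X i.1 i.2 ^ (m i : ℕ)) *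
          algebraMap (ZMod p) R (C m n) * ∏ i, Y i.1 i.2 ^ (n i : ℕ))
    [Fintype {W // IsLagrangian (scaledHermitianForm σ κ (2 * d)) W}] :
    (lagrangianOpposite (ZMod p) (scaledHermitianForm σ κ (2 * d))).rank = C.rank ^ t := by
  classical
  have hp2 : 2 ≤ p := (Fact.out : p.Prime).two_le
  have hq2 : 2 ≤ p ^ t := hp2.trans (Nat.le_self_pow (by omega) p)
  have hσσ (x : F) : σ (σ x) = x := by
    rw [hσ, hσ, ← pow_mul, ← sq, ← hF, FiniteField.pow_card]
  obtain ⟨ε, hε⟩ := exists_mul_pow_eq_neg_one hF hq2 (by rw [← hσ, map_neg, map_one])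
  obtain ⟨ω, hω1, hω⟩ := exists_ne_one_mul_pow_eq_one hF hq2
  rw [← hσ] at hε hω
  obtain ⟨Φ, hΦ⟩ := exists_hyperbolic_equiv hσσ hκ hκ0 hε hω hω1 d
  have hiff := isLagrangian_scaledHermitianForm_iff (σ := σ) hκ0 (d := d)
  let := ZMod.algebra F p
  have := Fintype.ofFinite (HermitianMatrix F (p ^ t) d)
  let f : HermitianMatrix F (p ^ t) d →
      {W // IsLagrangian (scaledHermitianForm σ κ (2 * d)) W} := fun X ↦
    ⟨graphSubspace Φ X.1, isLagrangian_graphSubspace hΦ fun i j ↦ by rw [hσ]; exact X.2 i j⟩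
  have hspan (W) := lagrangianOpposite_mem_span (k := ZMod p) p
    (scaledHermitianForm_skew hσσ hκ) (eq_zero_of_scaledHermitianForm_eq_zero hκ0)
    (fun W hW ↦ by rw [((hiff W).1 hW).1, Module.finrank_fin_fun]) _ (isLagrangian_map_inr hΦ) W
  rw [← (lagrangianOpposite_isSymm (ZMod p)).rank_submatrix_of_forall_mem_span f fun W ↦
      Submodule.span_mono ?_ (hspan W),
    ← Matrix.rank_map_ringHom (algebraMap (ZMod p) F), ← rank_det_sub_pow_hermitian ht hF (hC F)]
  · congr 1
    ext X Y
    simp only [Matrix.map_apply, Matrix.submatrix_apply, Matrix.of_apply, lagrangianOpposite, f,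
      graphSubspace_inf_eq_bot_iff]
    have hdet : (X.1 - Y.1).det ^ p ^ t = (X.1 - Y.1).det := by
      rw [← hσ, RingHom.map_det, ← Matrix.det_transpose]
      congr 1
      ext i j
      simp only [Matrix.transpose_apply, RingHom.mapMatrix_apply, Matrix.map_apply,
        Matrix.sub_apply, map_sub, hσ, ← X.2, ← Y.2]
    split_ifs with h
    · rw [map_one]
      refine (mul_right_cancel₀ h ?_).symm
      rw [pow_sub_one_mul (by omega), hdet, one_mul]
    · rw [map_zero, not_not.1 h, zero_pow (by omega)]
  · rintro _ ⟨⟨W, hWE⟩, rfl⟩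
    obtain ⟨X, hX, hXW⟩ := exists_graphSubspace_eq hΦ W.2 ((hiff _).1 W.2).1 hWE
    exact ⟨⟨X, fun i j ↦ by rw [hX, hσ]⟩, congrArg _ (Subtype.ext hXW)⟩

theorem rank_generator_opposite (ht : 1 ≤ t) (hF : Fintype.card F = (p ^ t) ^ 2)
    {C : Matrix (Fin d × Fin d → Fin p) (Fin d × Fin d → Fin p) (ZMod p)}
    (hC : ∀ (R : Type) [CommRing R] [Algebra (ZMod p) R] (X Y : Matrix (Fin d) (Fin d) R),
      (X - Y).det ^ (p - 1) = ∑ m, ∑ n, (∏ i, X i.1 i.2 ^ (m i : ℕ)) *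
          algebraMap (ZMod p) R (C m n) * ∏ i, Y i.1 i.2 ^ (n i : ℕ))
    {G : Type} [Fintype G]
    (e : G ≃ {W : Submodule F (Fin (2 * d) → F) // Module.finrank F W = d ∧
      ∀ x ∈ W, ∀ y ∈ W, ∑ i, x i * y i ^ (p ^ t) = 0})
    (A : Matrix G G (ZMod p)) (hA1 : ∀ a b, (e a).1 ⊓ (e b).1 = ⊥ → A a b = 1)
    (hA0 : ∀ a b, (e a).1 ⊓ (e b).1 ≠ ⊥ → A a b = 0) : A.rank = C.rank ^ t := by
  classical
  have hq2 : 2 ≤ p ^ t :=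
    (Fact.out : p.Prime).two_le.trans (Nat.le_self_pow (by omega) p)
  have : CharP F p := charP_of_card_eq_prime_pow (f := t * 2) (by rw [hF, pow_mul])
  let σ := iterateFrobenius F p t
  have hσ (x : F) : σ x = x ^ p ^ t := iterateFrobenius_def p t x
  obtain ⟨κ, hκ0, hκ⟩ := exists_ne_zero_pow_eq_neg hF hq2 (by rw [← hσ, map_neg, map_one])
  rw [← hσ] at hκ
  let e' := e.trans (Equiv.subtypeEquivRight (q := IsLagrangian (scaledHermitianForm σ κ (2 * d)))
    fun W ↦ by simp only [isLagrangian_scaledHermitianForm_iff hκ0, hσ])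
  have := Fintype.ofEquiv _ e'
  rw [← rank_lagrangianOpposite ht hF hσ hκ hκ0 hC, ← Matrix.rank_submatrix _ e' e']
  congr 1
  ext a b
  rw [Matrix.submatrix_apply, lagrangianOpposite]
  split_ifs with h
  · exact hA1 a b h
  · exact hA0 a b h

end OppositenessRank

/-- Proposition 5 for Hermitian polar spaces: with `q = pᵗ`, the `p`-rank of the
oppositeness matrix `Aq` of generators of `H(2d-1, q²)` is the `t`-th power of the `p`-rank
of the oppositeness matrix `Ap` of generators of `H(2d-1, p²)`. -/
theorem prank_oppositeness_hermitian_prime_power (p t d : ℕ) (hp : p.Prime) (ht : 1 ≤ t)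
    (hd : 2 ≤ d)
    (F : Type) [Field F] [Fintype F] (hF : Fintype.card F = (p ^ t) ^ 2)
    (K : Type) [Field K] [Fintype K] (hK : Fintype.card K = p ^ 2)
    (Gq : Type) [Fintype Gq]
    (eq : Gq ≃ {W : Submodule F (Fin (2 * d) → F) // Module.finrank F W = d ∧
      ∀ x ∈ W, ∀ y ∈ W, ∑ i, x i * y i ^ (p ^ t) = 0})
    (Gp : Type) [Fintype Gp]
    (ep : Gp ≃ {W : Submodule K (Fin (2 * d) → K) // Module.finrank K W = d ∧
      ∀ x ∈ W, ∀ y ∈ W, ∑ i, x i * y i ^ p = 0})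
    (Aq : Matrix Gq Gq (ZMod p))
    (hAq1 : ∀ a b : Gq, (eq a).1 ⊓ (eq b).1 = ⊥ → Aq a b = 1)
    (hAq0 : ∀ a b : Gq, (eq a).1 ⊓ (eq b).1 ≠ ⊥ → Aq a b = 0)
    (Ap : Matrix Gp Gp (ZMod p))
    (hAp1 : ∀ a b : Gp, (ep a).1 ⊓ (ep b).1 = ⊥ → Ap a b = 1)
    (hAp0 : ∀ a b : Gp, (ep a).1 ⊓ (ep b).1 ≠ ⊥ → Ap a b = 0) :
    Aq.rank = Ap.rank ^ t := by
  have := Fact.mk hp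
  obtain ⟨C, hC⟩ := exists_det_sub_pow_eq_sum p d
  rw [rank_generator_opposite ht hF hC eq Aq hAq1 hAq0,
    rank_generator_opposite le_rfl (t := 1) (by rw [pow_one, hK]) hC
      (ep.trans (Equiv.subtypeEquivRight fun W ↦ by rw [pow_one])) Ap hAp1 hAp0, pow_one]
end

section
/- Let p be a prime, t ≥ 1, and q = p^t. The rank over the field with p elements of the oppositeness matrix of lines of the Hermitian polar space H(3, q^2) equals ((2p^3 + p)/3)^t. -/
theorem Matrix.rank_map_of_field {K L n : Type*} [Field K] [Field L] [Fintype n]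
    (f : K →+* L) (M : Matrix n n K) : (M.map f).rank = M.rank := by
  classical
  obtain ⟨V, U, e, hV, hU, h⟩ := M.exists_rank_normal_form
  have hD : (M.map f).rank =
      ((Matrix.fromBlocks 1 0 0 0 : Matrix (Fin M.rank ⊕ Fin (Fintype.card n - M.rank))
        (Fin M.rank ⊕ Fin (Fintype.card n - M.rank)) L).submatrix e e).rank := by
    have h' : V.map f * M.map f * U.map f = (Matrix.fromBlocks 1 0 0 0).submatrix e e := by
      rw [← Matrix.map_mul, ← Matrix.map_mul, h, ← Matrix.submatrix_map, Matrix.fromBlocks_map]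
      simp
    have hV' : IsUnit (V.map f).det := by
      rw [← RingHom.mapMatrix_apply, ← RingHom.map_det]
      exact ((Matrix.isUnit_iff_isUnit_det _).1 hV).map f
    have hU' : IsUnit (U.map f).det := by
      rw [← RingHom.mapMatrix_apply, ← RingHom.map_det]
      exact ((Matrix.isUnit_iff_isUnit_det _).1 hU).map f
    rw [← h', Matrix.rank_mul_eq_left_of_isUnit_det _ _ hU',
      Matrix.rank_mul_eq_right_of_isUnit_det _ _ hV']
  rw [hD, Matrix.rank_submatrix, ← Matrix.diagonal_one, ← Matrix.diagonal_zero,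
    Matrix.fromBlocks_diagonal, Matrix.rank_diagonal, Fintype.card_subtype]
  have : (Finset.univ.filter fun i : Fin M.rank ⊕ Fin (Fintype.card n - M.rank) =>
      (Sum.elim (fun _ => (1 : L)) (fun _ => 0) : _ → L) i ≠ 0) =
      Finset.univ.map ⟨Sum.inl, Sum.inl_injective⟩ := by
    ext i
    rcases i with i | i <;> simp
  rw [this]
  simp

theorem Matrix.rank_mul_transpose_of_linearIndependent {K m n w : Type*} [Field K] [Fintype m]
    [Fintype n] [Fintype w] {P : Matrix m w K} {Q : Matrix n w K}
    (hP : LinearIndependent K P.col) (hQ : LinearIndependent K Q.col) :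
    (P * Q.transpose).rank = Fintype.card w := by
  have hQ' : Q.transpose.rank = Fintype.card w := LinearIndependent.rank_matrix hQ
  rw [← hQ', Matrix.rank, Matrix.rank, Matrix.mulVecLin_mul, LinearMap.range_comp]
  have hinj : Function.Injective P.mulVecLin := Matrix.mulVec_injective_iff.2 hP
  exact (Submodule.equivMapOfInjective _ hinj _).finrank_eq.symm

theorem Matrix.rank_submatrix_eq_of_span_col {K m n : Type*} [Field K] [Fintype m] [Fintype n]
    (M : Matrix m m K) (hM : M.IsSymm) (S : n → m)
    (hS : ∀ g, M.col g ∈ Submodule.span K (Set.range fun a => M.col (S a))) :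
    (M.submatrix S S).rank = M.rank := by
  have hS' : ∀ g, ∃ c : n → K, ∑ a, c a • M.col (S a) = M.col g := fun g =>
    (Submodule.mem_span_range_iff_exists_fun K).1 (hS g)
  choose c hc using hS'
  have h1 : M = M.submatrix id S * (Matrix.of c).transpose := by
    ext i g
    have := congrFun (hc g) i
    simp only [Finset.sum_apply, Pi.smul_apply, Matrix.col_apply, smul_eq_mul] at this
    simp [Matrix.mul_apply, ← this, mul_comm]
  have h2 : M.submatrix id S = Matrix.of c * M.submatrix S S := by
    have := congrArg Matrix.transpose h1
    rw [hM, Matrix.transpose_mul, Matrix.transpose_transpose, Matrix.transpose_submatrix, hM] at this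
    conv_lhs => rw [this]
    rfl
  apply le_antisymm
  · exact Matrix.rank_submatrix_le _ _ _
  · calc M.rank ≤ (M.submatrix id S).rank := by
          conv_lhs => rw [h1]
          exact Matrix.rank_mul_le_left _ _
      _ ≤ _ := by rw [h2]; exact Matrix.rank_mul_le_right _ _

section kernel

variable {p : ℕ} {F : Type*} [Field F]

theorem sub_pow_char_sub_one_eq_geom_sum (hp : p.Prime) [CharP F p] (u v : F) :
    (u - v) ^ (p - 1) = ∑ i : Fin p, u ^ (i : ℕ) * v ^ (p - 1 - i) := by
  have : Fact p.Prime := ⟨hp⟩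
  rw [Fin.sum_univ_eq_sum_range (fun i => u ^ i * v ^ (p - 1 - i)) p]
  rcases eq_or_ne u v with rfl | h
  · rw [geom_sum₂_self]
    have := hp.two_le
    simp [show p - 1 ≠ 0 by omega]
  · have h' : u - v ≠ 0 := sub_ne_zero.2 h
    apply mul_right_cancel₀ h'
    rw [geom_sum₂_mul, ← sub_pow_char, ← pow_succ, Nat.sub_add_cancel hp.one_le]

theorem factorial_mul_factorial_sq_eq_one (hp : p.Prime) [CharP F p] {i : ℕ} (hi : i < p) :
    ((i.factorial : F) * ((p - 1 - i).factorial : F)) ^ 2 = 1 := by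
  have : Fact p.Prime := ⟨hp⟩
  induction i with
  | zero =>
    have h := congrArg (ZMod.castHom (dvd_refl p) F) (ZMod.wilsons_lemma p)
    simp only [map_natCast, map_neg, map_one] at h
    simp [h]
  | succ i ih =>
    rw [← ih (by omega)]
    obtain ⟨k, rfl⟩ : ∃ k, p = i + 2 + k := ⟨p - (i + 2), by omega⟩
    rw [show i + 2 + k - 1 - (i + 1) = k by omega, show i + 2 + k - 1 - i = k + 1 by omega,
      Nat.factorial_succ, Nat.factorial_succ]
    have h0 : ((i + 2 + k : ℕ) : F) = 0 := CharP.cast_eq_zero F _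
    push_cast at h0 ⊢
    have h1 : (k : F) + 1 = -((i : F) + 1) := by linear_combination h0
    rw [h1]
    ring

/-- The divided power `x ^ k / k!`. -/
def dividedPow (x : F) (k : ℕ) : F := x ^ k / (k.factorial : F)

theorem natCast_factorial_ne_zero_of_lt (hp : p.Prime) [CharP F p] {i : ℕ} (hi : i < p) :
    (i.factorial : F) ≠ 0 := by
  rw [Ne, CharP.cast_eq_zero_iff F p, hp.dvd_factorial]
  omega

theorem add_pow_eq_sum_dividedPow (hp : p.Prime) [CharP F p] (u v : F) (i : Fin p) :
    (u + v) ^ (i : ℕ) = ((i : ℕ).factorial : F) * ∑ k : Fin p, ∑ l : Fin p,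
      if (k + l : ℕ) = i then dividedPow u k * dividedPow v l else 0 := by
  rw [add_pow, Finset.mul_sum]
  have key : ∀ k : Fin p, (∑ l : Fin p,
      if (k + l : ℕ) = i then dividedPow u k * dividedPow v l else 0) =
      if (k : ℕ) < i + 1 then dividedPow u k * dividedPow v ((i : ℕ) - k) else 0 := by
    intro k
    split_ifs with hk
    · rw [Finset.sum_eq_single (⟨i - k, by omega⟩ : Fin p)]
      · rw [if_pos (by simp; omega)]
      · intro b _ hb
        rw [if_neg]
        intro h
        exact hb (Fin.ext (by simp; omega))
      · simp
    · exact Finset.sum_eq_zero fun l _ => if_neg (by omega)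
  simp_rw [key]
  rw [Fin.sum_univ_eq_sum_range (fun k => ((i : ℕ).factorial : F) *
      if k < (i : ℕ) + 1 then dividedPow u k * dividedPow v ((i : ℕ) - k) else 0)]
  refine Finset.sum_subset_zero_on_sdiff (Finset.range_mono i.2) ?_ ?_
  · intro k hk
    rw [if_neg (by simp at hk ⊢; omega), mul_zero]
  · intro k hk
    rw [Finset.mem_range] at hk
    have hk' : k ≤ i := by omega
    have h1 := natCast_factorial_ne_zero_of_lt (F := F) hp (i := k) (by omega)
    have h2 := natCast_factorial_ne_zero_of_lt (F := F) hp (i := i - k) (by omega)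
    rw [if_pos hk, dividedPow, dividedPow, ← Nat.choose_mul_factorial_mul_factorial hk']
    push_cast
    field_simp

/-- The divided monomial with exponents `e`. -/
def dividedMonomial {ι : Type*} [Fintype ι] (e : ι → Fin p) (x : ι → F) : F :=
  ∏ j, dividedPow (x j) (e j)

/-- The torus weight of a monomial in the four entries of a `2 × 2` matrix. -/
def monomialWeight (e : Fin 4 → Fin p) : ℤ × ℤ × ℤ :=
  ((e 0 : ℤ) - e 1, (e 2 : ℤ) - e 3, (e 0 : ℤ) + e 2)

/-- The weight paired with `w` in the expansion of the `(p - 1)`-st power of a determinant. -/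
def dualWeight (p : ℕ) (w : ℤ × ℤ × ℤ) : ℤ × ℤ × ℤ :=
  (-w.1, -w.2.1, p - 1 - w.2.2)

theorem det_add_pow_eq_sum (hp : p.Prime) [CharP F p] (x y : Fin 4 → F) :
    ((x 0 + y 0) * (x 1 + y 1) - (x 2 + y 2) * (x 3 + y 3)) ^ (p - 1) =
      ∑ e : Fin 4 → Fin p, ∑ e' : Fin 4 → Fin p,
        if monomialWeight e = dualWeight p (monomialWeight e') then
          dividedMonomial e x * dividedMonomial e' y else 0 := by
  have : NeZero p := ⟨hp.ne_zero⟩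
  let N : Fin p → Fin 4 → Fin p := fun i => ![i, i, i.rev, i.rev]
  have h1 : ∀ i : Fin p, ((x 0 + y 0) * (x 1 + y 1)) ^ (i : ℕ) *
      ((x 2 + y 2) * (x 3 + y 3)) ^ (p - 1 - i) =
      ∑ e : Fin 4 → Fin p, ∑ e' : Fin 4 → Fin p,
        if ∀ j, (e j + e' j : ℕ) = N i j then
          dividedMonomial e x * dividedMonomial e' y else 0 := by
    intro i
    have hi : p - 1 - (i : ℕ) = (i.rev : ℕ) := by rw [Fin.val_rev]; omega
    have hfac := factorial_mul_factorial_sq_eq_one (F := F) hp i.2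
    rw [hi] at hfac ⊢
    calc _ = ∏ j, (x j + y j) ^ (N i j : ℕ) := by
          simp [Fin.prod_univ_four, N, mul_pow]
          ring
      _ = (∏ j, ((N i j : ℕ).factorial : F)) * ∏ j, ∑ k : Fin p, ∑ l : Fin p,
            if (k + l : ℕ) = N i j then dividedPow (x j) k * dividedPow (y j) l else 0 := by
          rw [← Finset.prod_mul_distrib]
          exact Finset.prod_congr rfl fun j _ => add_pow_eq_sum_dividedPow hp _ _ _
      _ = ∏ j, ∑ k : Fin p, ∑ l : Fin p,
            if (k + l : ℕ) = N i j then dividedPow (x j) k * dividedPow (y j) l else 0 := by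
          convert one_mul _
          rw [← hfac]
          simp [Fin.prod_univ_four, N]
          ring
      _ = _ := by
          rw [Finset.prod_univ_sum, Fintype.piFinset_univ]
          refine Finset.sum_congr rfl fun e _ => ?_
          rw [Finset.prod_univ_sum, Fintype.piFinset_univ]
          refine Finset.sum_congr rfl fun e' _ => ?_
          rw [Finset.prod_ite_zero, Finset.prod_mul_distrib]
          simp [dividedMonomial]
  rw [sub_pow_char_sub_one_eq_geom_sum hp, Finset.sum_congr rfl fun i _ => h1 i,
    Finset.sum_comm]
  refine Finset.sum_congr rfl fun e _ => ?_
  rw [Finset.sum_comm]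
  refine Finset.sum_congr rfl fun e' _ => ?_
  have hN : ∀ i : Fin p, (∀ j, (e j + e' j : ℕ) = N i j) ↔
      (e 0 + e' 0 : ℕ) = i ∧ (e 1 + e' 1 : ℕ) = i ∧ (e 2 + e' 2 : ℕ) + i + 1 = p ∧
        (e 3 + e' 3 : ℕ) + i + 1 = p := by
    intro i
    have := i.2
    simp only [Fin.forall_fin_succ, N]
    simp [Fin.val_rev]
    omega
  simp_rw [hN]
  simp only [monomialWeight, dualWeight, Prod.mk.injEq]
  split_ifs with h
  · rw [Finset.sum_eq_single (⟨e 0 + e' 0, by omega⟩ : Fin p), if_pos (by simp; omega)]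
    · intro b _ hb
      rw [if_neg]
      intro hb'
      exact hb (Fin.ext (by simp; omega))
    · simp
  · refine Finset.sum_eq_zero fun i _ => if_neg ?_
    omega

/-- The weights occurring in the expansion of the `(p - 1)`-st power of a determinant. -/
noncomputable def detWeights (p : ℕ) : Finset (ℤ × ℤ × ℤ) :=
  {w ∈ Finset.Icc (-p : ℤ) p ×ˢ Finset.Icc (-p : ℤ) p ×ˢ Finset.Icc (-p : ℤ) p |
    max w.1 0 + max w.2.1 0 ≤ w.2.2 ∧ w.2.2 + max (-w.1) 0 + max (-w.2.1) 0 + 1 ≤ p}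

theorem exists_monomialWeight_eq {w : ℤ × ℤ × ℤ} (hw : w ∈ detWeights p) :
    ∃ e : Fin 4 → Fin p, monomialWeight e = w := by
  obtain ⟨m, n, s⟩ := w
  simp only [detWeights, Finset.mem_filter] at hw
  refine ⟨![⟨(max m 0).toNat, by omega⟩, ⟨(max (-m) 0).toNat, by omega⟩,
    ⟨(s - max m 0).toNat, by omega⟩, ⟨(s - max m 0 - n).toNat, by omega⟩], ?_⟩
  simp [monomialWeight]
  omega

theorem exists_dualWeight_eq {w : ℤ × ℤ × ℤ} (hw : w ∈ detWeights p) :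
    ∃ e : Fin 4 → Fin p, dualWeight p (monomialWeight e) = w := by
  have hw' : dualWeight p w ∈ detWeights p := by
    simp only [detWeights, dualWeight, Finset.mem_filter, Finset.mem_product, Finset.mem_Icc]
      at hw ⊢
    omega
  obtain ⟨e, he⟩ := exists_monomialWeight_eq hw'
  exact ⟨e, by simp [he, dualWeight]⟩

theorem mem_detWeights_of_eq_dualWeight {e e' : Fin 4 → Fin p}
    (h : monomialWeight e = dualWeight p (monomialWeight e')) :
    monomialWeight e ∈ detWeights p := by
  simp only [monomialWeight, dualWeight, Prod.mk.injEq] at h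
  simp only [detWeights, monomialWeight, Finset.mem_filter, Finset.mem_product, Finset.mem_Icc]
  omega

theorem det_add_pow_eq_sum_weights (hp : p.Prime) [CharP F p] (x y : Fin 4 → F) :
    ((x 0 + y 0) * (x 1 + y 1) - (x 2 + y 2) * (x 3 + y 3)) ^ (p - 1) =
      ∑ w : detWeights p,
        (∑ e : Fin 4 → Fin p, if monomialWeight e = w then dividedMonomial e x else 0) *
        ∑ e : Fin 4 → Fin p,
          if dualWeight p (monomialWeight e) = w then dividedMonomial e y else 0 := by
  rw [det_add_pow_eq_sum hp]
  simp_rw [Finset.sum_mul_sum]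
  conv_rhs => rw [Finset.sum_comm]
  refine Finset.sum_congr rfl fun e _ => ?_
  conv_rhs => rw [Finset.sum_comm]
  refine Finset.sum_congr rfl fun e' _ => ?_
  split_ifs with h
  · rw [Finset.sum_eq_single ⟨_, mem_detWeights_of_eq_dualWeight h⟩]
    · simp [h]
    · intro w _ hw
      rw [if_neg fun h' => hw (Subtype.ext h'.symm), zero_mul]
    · simp
  · refine (Finset.sum_eq_zero fun w _ => ?_).symm
    split_ifs with h1 h2 <;> simp_all

end kernel

theorem sum_Icc_neg_natAbs (f : ℕ → ℕ) (N : ℕ) :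
    ∑ m ∈ Finset.Icc (-N : ℤ) N, f m.natAbs = f 0 + 2 * ∑ k ∈ Finset.range N, f (k + 1) := by
  induction N with
  | zero => simp
  | succ N ih =>
    have h : Finset.Icc (-(N + 1 : ℕ) : ℤ) (N + 1 : ℕ) =
        insert (-(N + 1 : ℕ) : ℤ) (insert ((N + 1 : ℕ) : ℤ) (Finset.Icc (-N : ℤ) N)) := by
      ext
      simp
      omega
    rw [h, Finset.sum_insert (by simp; omega), Finset.sum_insert (by simp), ih,
      Finset.sum_range_succ, Int.natAbs_neg, Int.natAbs_natCast]
    ring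

theorem two_mul_sum_range_tsub {M N : ℕ} (h : M ≤ N) :
    M + 2 * ∑ k ∈ Finset.range N, (M - (k + 1)) = M ^ 2 := by
  induction N generalizing M with
  | zero => simp_all
  | succ N ih =>
    rcases M with _ | M
    · simp
    · have := ih (Nat.le_of_succ_le_succ h)
      rw [Finset.sum_range_succ']
      simp only [Nat.add_sub_add_right, zero_add, Nat.add_sub_cancel]
      linarith

theorem three_mul_sq_add_two_mul_sum_range_tsub_sq (N : ℕ) :
    3 * (N ^ 2 + 2 * ∑ k ∈ Finset.range N, (N - (k + 1)) ^ 2) = 2 * N ^ 3 + N := by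
  induction N with
  | zero => simp
  | succ N ih =>
    rw [Finset.sum_range_succ']
    simp only [Nat.add_sub_add_right, zero_add, Nat.add_sub_cancel]
    linarith

theorem three_mul_card_detWeights (p : ℕ) : 3 * (detWeights p).card = 2 * p ^ 3 + p := by
  have h : (detWeights p).card = ∑ m ∈ Finset.Icc (-p : ℤ) p, ∑ n ∈ Finset.Icc (-p : ℤ) p,
      (p - m.natAbs - n.natAbs) := by
    rw [detWeights, Finset.card_filter, Finset.sum_product]
    refine Finset.sum_congr rfl fun m hm => ?_
    rw [Finset.sum_product]
    refine Finset.sum_congr rfl fun n hn => ?_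
    rw [← Finset.card_filter]
    have : {s ∈ Finset.Icc (-p : ℤ) p | max m 0 + max n 0 ≤ s ∧
        s + max (-m) 0 + max (-n) 0 + 1 ≤ p} =
        Finset.Ico (max m 0 + max n 0) (p - max (-m) 0 - max (-n) 0) := by
      ext s
      simp only [Finset.mem_filter, Finset.mem_Icc, Finset.mem_Ico]
      omega
    rw [this, Int.card_Ico]
    omega
  have h' := sum_Icc_neg_natAbs (fun k => (p - k) ^ 2) p
  rw [Nat.sub_zero] at h'
  rw [h, ← three_mul_sq_add_two_mul_sum_range_tsub_sq, ← h']
  congr 1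
  refine Finset.sum_congr rfl fun m hm => ?_
  have h'' := sum_Icc_neg_natAbs (fun k => p - m.natAbs - k) p
  rw [Nat.sub_zero] at h''
  rw [h'', two_mul_sum_range_tsub (Nat.sub_le _ _)]

section frobenius

variable {F : Type*} [Field F]

theorem linearIndependent_pow_of_injective {X : Type*} [Fintype X] {N : ℕ} {g : X → F}
    (hg : Function.Injective g) (hN : N ≤ Fintype.card X) :
    LinearIndependent F (fun (k : Fin N) (x : X) => g x ^ (k : ℕ)) := by
  rw [Fintype.linearIndependent_iff]
  intro c hc
  let ι : Fin N → X := fun k => (Fintype.equivFin X).symm (Fin.castLE hN k)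
  have hι : Function.Injective (g ∘ ι) :=
    hg.comp ((Fintype.equivFin X).symm.injective.comp (Fin.castLE_injective hN))
  have := Matrix.eq_zero_of_forall_index_sum_pow_mul_eq_zero hι (v := c) fun j => by
    have := congrFun hc (ι j)
    simpa [mul_comm] using this
  exact congrFun this

theorem LinearIndependent.mul_prod {X Y ι κ : Type*} [Fintype ι] [Fintype κ]
    {f : ι → X → F} {g : κ → Y → F} (hf : LinearIndependent F f) (hg : LinearIndependent F g) :
    LinearIndependent F (fun (i : ι × κ) (x : X × Y) => f i.1 x.1 * g i.2 x.2) := by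
  rw [Fintype.linearIndependent_iff] at *
  intro c hc i
  refine hg (fun k => c (i.1, k)) ?_ i.2
  ext y
  simp only [Finset.sum_apply, Pi.smul_apply, smul_eq_mul, Pi.zero_apply]
  refine hf (fun j => ∑ k, c (j, k) * g k y) ?_ i.1
  ext x
  have := congrFun hc (x, y)
  simp only [Finset.sum_apply, Pi.smul_apply, smul_eq_mul, Pi.zero_apply,
    Fintype.sum_prod_type] at this ⊢
  rw [← this]
  refine Finset.sum_congr rfl fun j _ => ?_
  rw [Finset.sum_mul]
  refine Finset.sum_congr rfl fun k _ => ?_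
  ring

variable {p t : ℕ}

theorem card_pow_eq_neg_ge [Fintype F] [CharP F p] (hp : p.Prime) (ht : 1 ≤ t)
    (hF : Fintype.card F = (p ^ t) ^ 2) [Fintype {a : F // a ^ p ^ t = -a}] :
    p ^ t ≤ Fintype.card {a : F // a ^ p ^ t = -a} := by
  classical
  have : Fact p.Prime := ⟨hp⟩
  have hq : 1 < p ^ t := Nat.one_lt_pow (by omega) hp.one_lt
  let φ : F →+ F :=
    { toFun := fun a => a ^ p ^ t + a
      map_zero' := by simp [hp.ne_zero]
      map_add' := fun a b => by rw [add_pow_char_pow]; ring }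
  have hker : Nat.card φ.ker = Fintype.card {a : F // a ^ p ^ t = -a} := by
    rw [← Nat.card_eq_fintype_card]
    refine Nat.card_congr (Equiv.subtypeEquivRight fun a => ?_)
    rw [AddMonoidHom.mem_ker]
    exact add_eq_zero_iff_eq_neg
  have hrange : Nat.card φ.range ≤ p ^ t := by
    have hsub : (φ.range : Set F) ⊆ ((Polynomial.X ^ p ^ t - Polynomial.X :
        Polynomial F).roots.toFinset : Set F) := by
      rintro _ ⟨a, rfl⟩
      have h2 : a ^ (p ^ t) ^ 2 = a := by rw [← hF]; exact FiniteField.pow_card a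
      simp only [Finset.mem_coe, Multiset.mem_toFinset]
      rw [Polynomial.mem_roots (FiniteField.X_pow_card_sub_X_ne_zero F hq)]
      simp only [Polynomial.IsRoot, Polynomial.eval_sub, Polynomial.eval_pow, Polynomial.eval_X]
      change (a ^ p ^ t + a) ^ p ^ t - (a ^ p ^ t + a) = 0
      rw [add_pow_char_pow, ← pow_mul, ← pow_two, h2]
      ring
    calc Nat.card φ.range = (φ.range : Set F).ncard := rfl
      _ ≤ _ := Set.ncard_le_ncard hsub (Finset.finite_toSet _)
      _ = _ := Set.ncard_coe_finset _
      _ ≤ _ := Multiset.toFinset_card_le _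
      _ ≤ _ := Polynomial.card_roots' _
      _ = _ := FiniteField.X_pow_card_sub_X_natDegree_eq F hq
  have hmul := φ.ker.card_mul_index
  rw [AddSubgroup.index_ker, hker, Nat.card_eq_fintype_card (α := F), hF] at hmul
  have hpos : 0 < p ^ t := by omega
  nlinarith

theorem linearIndependent_skewHermitian_monomials [Fintype F] [CharP F p] (hp : p.Prime)
    (ht : 1 ≤ t) (hF : Fintype.card F = (p ^ t) ^ 2) :
    LinearIndependent F (fun (E : Fin t → Fin 4 → Fin p)
      (u : {a : F // a ^ p ^ t = -a} × {a : F // a ^ p ^ t = -a} × F) =>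
      ∏ i, (∏ j, (![u.1.1, u.2.1.1, u.2.2, u.2.2 ^ p ^ t] j) ^ (E i j : ℕ)) ^ p ^ (i : ℕ)) := by
  classical
  have hS := card_pow_eq_neg_ge hp ht hF
  have h1 := linearIndependent_pow_of_injective
    (Subtype.val_injective (p := fun a : F => a ^ p ^ t = -a)) hS
  have h2 := linearIndependent_pow_of_injective (N := p ^ t * p ^ t)
    (Function.injective_id (α := F)) (by rw [hF, pow_two])
  have h3 := h1.mul_prod (h1.mul_prod h2)
  let ν : Fin 4 → (Fin t → Fin 4 → Fin p) → Fin (p ^ t) :=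
    fun j E => finFunctionFinEquiv fun i => E i j
  have hinj : Function.Injective fun E : Fin t → Fin 4 → Fin p =>
      (ν 0 E, ν 1 E, finProdFinEquiv (ν 3 E, ν 2 E)) := by
    intro E E' h
    simp only [Prod.mk.injEq, EmbeddingLike.apply_eq_iff_eq, ν, funext_iff] at h
    ext i j
    fin_cases j <;> simp [h]
  convert h3.comp _ hinj using 1
  ext E u
  obtain ⟨a, d, b⟩ := u
  have hν : ∀ j (z : F), z ^ (ν j E : ℕ) = ∏ i, (z ^ (E i j : ℕ)) ^ p ^ (i : ℕ) := by
    intro j z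
    simp only [ν, finFunctionFinEquiv_apply, Finset.prod_pow_eq_pow_sum, ← pow_mul]
  simp only [Function.comp, id, finProdFinEquiv_apply_val, pow_add, pow_mul, hν,
    Fin.prod_univ_four, mul_pow, Finset.prod_mul_distrib]
  simp
  ring

end frobenius

section chart

variable {p t : ℕ} {F : Type*} [Field F]

theorem linearIndependent_prod_sum_of_linearIndependent_monomials [CharP F p] (hp : p.Prime)
    {U ι W W₀ : Type*} [Fintype U] [Fintype ι] [DecidableEq ι] [Fintype W] [DecidableEq W₀]
    (x : U → ι → F) (s : ι → F) (hs : ∀ j, s j ≠ 0)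
    (hx : LinearIndependent F (fun (E : Fin t → ι → Fin p) (u : U) =>
      ∏ i, (∏ j, x u j ^ (E i j : ℕ)) ^ p ^ (i : ℕ)))
    (ε : W → W₀) (hε : Function.Injective ε) (wt : (ι → Fin p) → W₀)
    (hwt : ∀ w, ∃ e, wt e = ε w) :
    LinearIndependent F (fun (ω : Fin t → W) (u : U) =>
      ∏ i, (∑ e : ι → Fin p, if wt e = ε (ω i) then
        dividedMonomial e (fun j => s j * x u j) else 0) ^ p ^ (i : ℕ)) := by
  classical
  have : Fact p.Prime := ⟨hp⟩
  let c : (Fin t → ι → Fin p) → F := fun E =>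
    ∏ i, (∏ j, (s j ^ (E i j : ℕ) / ((E i j : ℕ).factorial : F))) ^ p ^ (i : ℕ)
  have hc : ∀ E, c E ≠ 0 := fun E =>
    Finset.prod_ne_zero_iff.2 fun i _ => pow_ne_zero _ <| Finset.prod_ne_zero_iff.2 fun j _ =>
      div_ne_zero (pow_ne_zero _ (hs j)) (natCast_factorial_ne_zero_of_lt hp (E i j).2)
  have hexp : ∀ (ω : Fin t → W) (u : U),
      ∏ i, (∑ e : ι → Fin p, if wt e = ε (ω i) then
        dividedMonomial e (fun j => s j * x u j) else 0) ^ p ^ (i : ℕ) =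
      ∑ E : Fin t → ι → Fin p, (if ∀ i, wt (E i) = ε (ω i) then c E else 0) *
        ∏ i, (∏ j, x u j ^ (E i j : ℕ)) ^ p ^ (i : ℕ) := by
    intro ω u
    simp_rw [sum_pow_char_pow]
    rw [Finset.prod_univ_sum, Fintype.piFinset_univ]
    refine Finset.sum_congr rfl fun E _ => ?_
    have h0 : ∀ i : ℕ, p ^ i ≠ 0 := fun i => pow_ne_zero _ hp.ne_zero
    simp_rw [ite_pow, zero_pow (h0 _)]
    rw [Finset.prod_ite_zero]
    simp only [Finset.mem_univ, true_imp_iff]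
    split_ifs
    · rw [← Finset.prod_mul_distrib]
      refine Finset.prod_congr rfl fun i _ => ?_
      rw [← mul_pow, ← Finset.prod_mul_distrib, dividedMonomial]
      congr 1
      refine Finset.prod_congr rfl fun j _ => ?_
      rw [dividedPow, mul_pow]
      ring
    · simp
  simp_rw [hexp]
  rw [Fintype.linearIndependent_iff] at hx ⊢
  intro g hg ω
  choose e he using hwt
  have key := hx (fun E => ∑ ω, g ω * if ∀ i, wt (E i) = ε (ω i) then c E else 0) (by
    rw [← hg]
    ext u
    simp only [Finset.sum_apply, Pi.smul_apply, smul_eq_mul, Finset.sum_mul, Finset.mul_sum]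
    rw [Finset.sum_comm]
    simp only [mul_assoc]) (fun i => e (ω i))
  rw [Finset.sum_eq_single ω] at key
  · simpa [he, hc] using key
  · intro ω' _ hω'
    rw [if_neg, mul_zero]
    intro h
    exact hω' (funext fun i => hε (by rw [← h i, he]))
  · simp

/-- The determinant of the difference of the skew-Hermitian matrices with entries `u` and `v`. -/
def skewHermitianDetSub (q : ℕ) (u v : {a : F // a ^ q = -a} × {a : F // a ^ q = -a} × F) : F :=
  (u.1.1 - v.1.1) * (u.2.1.1 - v.2.1.1) + (u.2.2 - v.2.2) * (u.2.2 ^ q - v.2.2 ^ q)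

theorem rank_skewHermitianDetSub_pow [Fintype F] [CharP F p] (hp : p.Prime) (ht : 1 ≤ t)
    (hF : Fintype.card F = (p ^ t) ^ 2)
    [Fintype ({a : F // a ^ p ^ t = -a} × {a : F // a ^ p ^ t = -a} × F)] :
    (Matrix.of fun u v => skewHermitianDetSub (F := F) (p ^ t) u v ^ (p ^ t - 1)).rank =
      (detWeights p).card ^ t := by
  classical
  have : Fact p.Prime := ⟨hp⟩
  let U := {a : F // a ^ p ^ t = -a} × {a : F // a ^ p ^ t = -a} × F
  let z : U → Fin 4 → F := fun u => ![u.1.1, u.2.1.1, u.2.2, u.2.2 ^ p ^ t]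
  have hz := linearIndependent_skewHermitian_monomials hp ht hF
  let s : Fin 4 → F := ![1, 1, 1, -1]
  let s' : Fin 4 → F := ![-1, -1, -1, 1]
  have hs : ∀ j, s j ≠ 0 := by simp [Fin.forall_fin_succ, s]
  have hs' : ∀ j, s' j ≠ 0 := by simp [Fin.forall_fin_succ, s']
  have hP := linearIndependent_prod_sum_of_linearIndependent_monomials hp z s hs hz
    (fun w : detWeights p => w.1) Subtype.val_injective monomialWeight
    fun w => exists_monomialWeight_eq w.2
  have hQ := linearIndependent_prod_sum_of_linearIndependent_monomials hp z s' hs' hz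
    (fun w : detWeights p => w.1) Subtype.val_injective
    (fun e => dualWeight p (monomialWeight e)) fun w => exists_dualWeight_eq w.2
  let P : Matrix U (Fin t → detWeights p) F := Matrix.of fun u ω =>
    ∏ i, (∑ e : Fin 4 → Fin p, if monomialWeight e = (ω i).1 then
      dividedMonomial e (fun j => s j * z u j) else 0) ^ p ^ (i : ℕ)
  let Q : Matrix U (Fin t → detWeights p) F := Matrix.of fun u ω =>
    ∏ i, (∑ e : Fin 4 → Fin p, if dualWeight p (monomialWeight e) = (ω i).1 then
      dividedMonomial e (fun j => s' j * z u j) else 0) ^ p ^ (i : ℕ)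
  have hrank := Matrix.rank_mul_transpose_of_linearIndependent (P := P) (Q := Q) hP hQ
  rw [Fintype.card_fun, Fintype.card_coe, Fintype.card_fin] at hrank
  rw [← hrank]
  congr 1
  · ext u v
    have hdet : skewHermitianDetSub (p ^ t) u v =
        ((s 0 * z u 0 + s' 0 * z v 0) * (s 1 * z u 1 + s' 1 * z v 1) -
          (s 2 * z u 2 + s' 2 * z v 2) * (s 3 * z u 3 + s' 3 * z v 3)) := by
      simp [s, s', z, skewHermitianDetSub]
      ring
    have hpow : p ^ t - 1 = ∑ i : Fin t, (p - 1) * p ^ (i : ℕ) := by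
      rw [← Finset.mul_sum, Fin.sum_univ_eq_sum_range (fun i => p ^ i), mul_comm,
        Nat.geomSum_eq hp.two_le, Nat.div_mul_cancel (Nat.sub_one_dvd_pow_sub_one p t)]
    rw [Matrix.of_apply, hdet, hpow, ← Finset.prod_pow_eq_pow_sum]
    simp_rw [pow_mul]
    rw [det_add_pow_eq_sum_weights hp (fun j => s j * z u j) (fun j => s' j * z v j)]
    simp_rw [sum_pow_char_pow, mul_pow]
    rw [Finset.prod_univ_sum, Fintype.piFinset_univ]
    simp only [Matrix.mul_apply, Matrix.transpose_apply, Finset.prod_mul_distrib, P, Q,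
      Matrix.of_apply]

end chart

section geometry

variable {F : Type*} [Field F] (σ : F →+* F)

/-- The Hermitian form `∑ xᵢ σ(yᵢ)`. -/
def hermForm {ι : Type*} [Fintype ι] (x y : ι → F) : F := ∑ i, x i * σ (y i)

section form

variable {ι : Type*} [Fintype ι]

theorem hermForm_add_left (x y z : ι → F) :
    hermForm σ (x + y) z = hermForm σ x z + hermForm σ y z := by
  simp [hermForm, add_mul, Finset.sum_add_distrib]

theorem hermForm_add_right (x y z : ι → F) :
    hermForm σ x (y + z) = hermForm σ x y + hermForm σ x z := by
  simp [hermForm, mul_add, Finset.sum_add_distrib]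

theorem hermForm_smul_left (c : F) (x y : ι → F) :
    hermForm σ (c • x) y = c * hermForm σ x y := by
  simp [hermForm, Finset.mul_sum, mul_assoc]

theorem hermForm_smul_right (c : F) (x y : ι → F) :
    hermForm σ x (c • y) = σ c * hermForm σ x y := by
  simp only [hermForm, Finset.mul_sum, Pi.smul_apply, smul_eq_mul, map_mul]
  exact Finset.sum_congr rfl fun i _ => by ring

variable {σ}

theorem map_hermForm (hσ : ∀ a, σ (σ a) = a) (x y : ι → F) :
    σ (hermForm σ x y) = hermForm σ y x := by
  simp [hermForm, hσ, mul_comm]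

end form

/-- The functional `x ↦ h(x, y)`. -/
def hermFunctional {ι : Type*} [Fintype ι] (y : ι → F) : (ι → F) →ₗ[F] F where
  toFun x := hermForm σ x y
  map_add' x z := hermForm_add_left σ x z y
  map_smul' c x := hermForm_smul_left σ c x y

/-- Two-dimensional totally isotropic subspaces. -/
def IsHermGenerator (W : Submodule F (Fin 4 → F)) : Prop :=
  Module.finrank F W = 2 ∧ ∀ x ∈ W, ∀ y ∈ W, hermForm σ x y = 0

variable {σ}

theorem span_pair_eq_of_finrank_eq_two {V : Type*} [AddCommGroup V] [Module F V]
    {W : Submodule F V} (hW : Module.finrank F W = 2) {a b : V} (ha : a ∈ W) (hb : b ∈ W)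
    (hab : LinearIndependent F ![a, b]) : Submodule.span F {a, b} = W := by
  have : FiniteDimensional F W := FiniteDimensional.of_finrank_pos (by omega)
  apply Submodule.eq_of_le_of_finrank_eq
  · rw [Submodule.span_le]
    rintro x (rfl | rfl)
    exacts [ha, hb]
  · have := finrank_span_eq_card hab
    rw [Matrix.range_cons, Matrix.range_cons, Matrix.range_empty, Set.union_empty,
      Set.singleton_union] at this
    rw [this, hW, Fintype.card_fin]

namespace IsHermGenerator

variable {W Y L : Submodule F (Fin 4 → F)}

theorem mem_of_orthogonal (hσ : ∀ a, σ (σ a) = a) (hW : IsHermGenerator σ W) {v : Fin 4 → F}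
    (hv : ∀ w ∈ W, hermForm σ v w = 0) : v ∈ W := by
  by_contra hvW
  let w := Module.finBasisOfFinrankEq F W hW.1
  let w' : Fin 2 → Fin 4 → F := fun i => (w i : Fin 4 → F)
  have hw : LinearIndependent F w' := w.linearIndependent.map' W.subtype W.ker_subtype
  have hspan : Submodule.span F (Set.range w') ≤ W := by
    rw [Submodule.span_le]
    rintro _ ⟨i, rfl⟩
    exact (w i).2
  have hvw : LinearIndependent F (Fin.cons v w' : Fin 3 → Fin 4 → F) :=
    linearIndependent_finCons.2 ⟨hw, fun h => hvW (hspan h)⟩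
  have hσw : LinearIndependent F fun i j => σ (w' i j) := by
    refine hw.map_of_surjective_injective σ (AddMonoidHom.compLeft σ.toAddMonoidHom (Fin 4))
      (fun a => ⟨σ a, hσ a⟩) (fun x hx => ?_) (fun r m => ?_)
    · funext j
      exact σ.injective ((congrFun hx j).trans (map_zero σ).symm)
    · funext j
      exact map_mul σ r (m j)
  have hmul : (Matrix.of (Fin.cons v w' : Fin 3 → Fin 4 → F)) *
      (Matrix.of fun i j => σ (w' i j)).transpose = 0 := by
    ext i j
    refine Fin.cases ?_ (fun i => ?_) i
    · exact hv _ (w j).2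
    · exact hW.2 _ (w i).2 _ (w j).2
  have h1 := Matrix.rank_add_rank_le_card_of_mul_eq_zero hmul
  have h2 : (Matrix.of (Fin.cons v w' : Fin 3 → Fin 4 → F)).rank = 3 := by
    simpa using LinearIndependent.rank_matrix
      (M := Matrix.of (Fin.cons v w' : Fin 3 → Fin 4 → F)) hvw
  have h3 : (Matrix.of fun i j => σ (w' i j)).rank = 2 := by
    simpa using LinearIndependent.rank_matrix (M := Matrix.of fun i j => σ (w' i j)) hσw
  rw [Matrix.rank_transpose, h2, h3] at h1
  simp at h1

theorem exists_mem_ne_zero_orthogonal (hW : IsHermGenerator σ W) (v : Fin 4 → F) :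
    ∃ f ∈ W, f ≠ 0 ∧ hermForm σ f v = 0 := by
  have h := LinearMap.ker_ne_bot_of_finrank_lt (f := (hermFunctional σ v).comp W.subtype)
    (by rw [hW.1]; simp)
  obtain ⟨x, hx, hx0⟩ := Submodule.exists_mem_ne_zero_of_ne_bot h
  exact ⟨x, x.2, fun h => hx0 (Subtype.ext h), hx⟩

theorem eq_of_mem_of_inf_ne_bot (hσ : ∀ a, σ (σ a) = a) (hY : IsHermGenerator σ Y)
    (hW : IsHermGenerator σ W) (hL : IsHermGenerator σ L) {v : Fin 4 → F} (hvY : v ∉ Y)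
    (hvW : v ∈ W) (hvL : v ∈ L) (hWY : W ⊓ Y ≠ ⊥) (hLY : L ⊓ Y ≠ ⊥) : W = L := by
  obtain ⟨f, ⟨hfW, hfY⟩, hf0⟩ := Submodule.exists_mem_ne_zero_of_ne_bot hWY
  obtain ⟨g, ⟨hgL, hgY⟩, hg0⟩ := Submodule.exists_mem_ne_zero_of_ne_bot hLY
  have hdep : ∃ a : F, a • g = f := by
    by_contra! hne
    have hspan := span_pair_eq_of_finrank_eq_two hY.1 hgY hfY
      ((LinearIndependent.pair_iff' hg0).2 hne)
    refine hvY (hY.mem_of_orthogonal hσ fun w hw => ?_)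
    rw [← hspan, Submodule.mem_span_pair] at hw
    obtain ⟨a, b, rfl⟩ := hw
    rw [hermForm_add_right, hermForm_smul_right, hermForm_smul_right, hL.2 v hvL g hgL,
      hW.2 v hvW f hfW]
    simp
  obtain ⟨a, rfl⟩ := hdep
  have hind : LinearIndependent F ![a • g, v] :=
    (LinearIndependent.pair_iff' hf0).2 fun b hb => hvY (hb ▸ Y.smul_mem b hfY)
  rw [← span_pair_eq_of_finrank_eq_two hW.1 hfW hvW hind,
    ← span_pair_eq_of_finrank_eq_two hL.1 (L.smul_mem a hgL) hvL hind]

end IsHermGenerator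

/-- The nilpotent part of the unitary transvection with centre `f` and parameter `s`. -/
def transvectionNilpotent (σ : F →+* F) (s : F) (f : Fin 4 → F) : Module.End F (Fin 4 → F) :=
  (hermFunctional σ f).smulRight (s • f)

theorem transvectionNilpotent_apply (s : F) (f x : Fin 4 → F) :
    transvectionNilpotent σ s f x = hermForm σ x f • s • f := rfl

theorem one_add_transvectionNilpotent_pow {s : F} {f : Fin 4 → F} (hf : hermForm σ f f = 0)
    (k : ℕ) :
    (1 + transvectionNilpotent σ s f) ^ k = 1 + k • transvectionNilpotent σ s f := by
  have hN : transvectionNilpotent σ s f * transvectionNilpotent σ s f = 0 := by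
    refine LinearMap.ext fun x => ?_
    simp [transvectionNilpotent_apply, hf]
  induction k with
  | zero => simp
  | succ k ih =>
    rw [pow_succ, ih, add_mul, one_mul, mul_add, mul_one, smul_mul_assoc, hN, smul_zero, add_zero,
      succ_nsmul]
    abel

theorem hermForm_transvection (hσ : ∀ a, σ (σ a) = a) {s : F} (hs : σ s = -s) {f : Fin 4 → F}
    (hf : hermForm σ f f = 0) (x y : Fin 4 → F) :
    hermForm σ ((1 + transvectionNilpotent σ s f) x) ((1 + transvectionNilpotent σ s f) y) =
      hermForm σ x y := by
  simp only [LinearMap.add_apply, Module.End.one_apply, transvectionNilpotent_apply,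
    hermForm_add_left, hermForm_add_right, hermForm_smul_left, hermForm_smul_right, hf,
    map_hermForm hσ, hs]
  ring

theorem card_generators_through_opposite [Fintype F] {p : ℕ} [CharP F p] (hp : p.Prime)
    (hσ : ∀ a, σ (σ a) = a) {s : F} (hs0 : s ≠ 0) (hs : σ s = -s) {Y : Submodule F (Fin 4 → F)}
    (hY : IsHermGenerator σ Y) (v : Fin 4 → F) :
    p ∣ Nat.card {g : Submodule F (Fin 4 → F) // IsHermGenerator σ g ∧ v ∈ g ∧ Y ⊓ g = ⊥} := by
  classical
  have : Fact p.Prime := ⟨hp⟩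
  obtain ⟨f, hfY, hf0, hfv⟩ := hY.exists_mem_ne_zero_orthogonal v
  have hff : hermForm σ f f = 0 := hY.2 f hfY f hfY
  have hvf : hermForm σ v f = 0 := by rw [← map_hermForm hσ, hfv, map_zero]
  set T := 1 + transvectionNilpotent σ s f with hT
  have hTp : T ^ p = 1 := by
    rw [hT, one_add_transvectionNilpotent_pow hff, ← Nat.cast_smul_eq_nsmul F, CharP.cast_eq_zero]
    simp
  have hTinj : Function.Injective T := by
    have : IsUnit T := IsUnit.of_pow_eq_one hTp hp.ne_zero
    exact ((Module.End.isUnit_iff _).1 this).1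
  have hTY : ∀ y ∈ Y, T y = y := fun y hy => by
    simp [hT, transvectionNilpotent_apply, hY.2 y hy f hfY]
  have hTv : T v = v := by simp [hT, transvectionNilpotent_apply, hvf]
  let X := {g : Submodule F (Fin 4 → F) // IsHermGenerator σ g ∧ v ∈ g ∧ Y ⊓ g = ⊥}
  have : Fintype X := Fintype.ofFinite X
  let τ : Function.End X := fun g => ⟨g.1.map T, by
    refine ⟨⟨?_, ?_⟩, ⟨v, g.2.2.1, hTv⟩, ?_⟩
    · rw [← g.2.1.1]
      exact (Submodule.equivMapOfInjective T hTinj g.1).finrank_eq.symm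
    · rintro _ ⟨x, hx, rfl⟩ _ ⟨y, hy, rfl⟩
      rw [hermForm_transvection hσ hs hff]
      exact g.2.1.2 x hx y hy
    · rw [eq_bot_iff]
      rintro _ ⟨hxY, ⟨x, hx, rfl⟩⟩
      have h1 : T (T x) = T x := hTY _ hxY
      have h2 : T x = x := hTinj h1
      rw [h2] at hxY ⊢
      rw [← g.2.2.2]
      exact ⟨hxY, hx⟩⟩
  have hpow : ∀ (k : ℕ) (g : X), ((τ ^ k) g).1 = g.1.map (T ^ k) := by
    intro k
    induction k with
    | zero => intro g; rw [pow_zero, pow_zero, Module.End.one_eq_id, Submodule.map_id]; rfl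
    | succ k ih =>
      intro g
      rw [pow_succ, pow_succ, Module.End.mul_eq_comp, Submodule.map_comp]
      exact ih (τ g)
  have hτ : τ ^ p ^ 1 = 1 := by
    funext g
    refine Subtype.ext ?_
    rw [pow_one, hpow, hTp, Module.End.one_eq_id, Submodule.map_id]
    rfl
  have hmod := Equiv.Perm.card_fixedPoints_modEq hτ
  have hfix : IsEmpty (Function.fixedPoints τ) := by
    refine ⟨fun ⟨g, hg⟩ => ?_⟩
    have hfg : f ∉ g.1 := fun h => hf0 <| by
      have : f ∈ Y ⊓ g.1 := ⟨hfY, h⟩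
      rwa [g.2.2.2] at this
    have hex : ∃ w ∈ g.1, hermForm σ f w ≠ 0 := by
      by_contra! h
      exact hfg (g.2.1.mem_of_orthogonal hσ h)
    obtain ⟨w, hw, hfw⟩ := hex
    have hTw : T w ∈ g.1 := by
      have : T w ∈ (τ g).1 := ⟨w, hw, rfl⟩
      rwa [hg] at this
    have hsub := g.1.sub_mem hTw hw
    rw [hT] at hsub
    simp only [LinearMap.add_apply, Module.End.one_apply, transvectionNilpotent_apply,
      add_sub_cancel_left] at hsub
    rw [smul_smul] at hsub
    refine hfg ((Submodule.smul_mem_iff _ (mul_ne_zero (fun h => hfw ?_) hs0)).1 hsub)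
    rw [← map_hermForm hσ, h, map_zero]
  rw [Nat.card_eq_fintype_card]
  refine (Nat.modEq_zero_iff_dvd).1 (hmod.trans ?_)
  rw [Fintype.card_eq_zero]

end geometry

section oppositeness

variable {F : Type*} [Field F] (σ : F →+* F)

open Classical in
/-- The oppositeness matrix of the generators, with entries in the ground field. -/
noncomputable def hermOppositeness :
    Matrix {W // IsHermGenerator σ W} {W // IsHermGenerator σ W} F :=
  Matrix.of fun a b => if a.1 ⊓ b.1 = ⊥ then 1 else 0

variable {σ}

theorem hermOppositeness_isSymm : (hermOppositeness σ).IsSymm := by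
  ext a b
  simp [hermOppositeness, inf_comm]

open Classical in
theorem sum_hermOppositeness_through_eq_zero [Fintype F] [Fintype {W // IsHermGenerator σ W}]
    {p : ℕ} [CharP F p] (hp : p.Prime) (hσ : ∀ a, σ (σ a) = a) {s : F} (hs0 : s ≠ 0)
    (hs : σ s = -s) (v : Fin 4 → F) :
    ∑ g : {W // IsHermGenerator σ W} with v ∈ g.1, (hermOppositeness σ).col g = 0 := by
  funext Y
  rw [Finset.sum_apply]
  simp only [Matrix.col_apply, hermOppositeness, Matrix.of_apply, Pi.zero_apply]
  rw [Finset.sum_boole, CharP.cast_eq_zero_iff F p, Finset.filter_filter, ← Fintype.card_subtype,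
    ← Nat.card_eq_fintype_card]
  have h := card_generators_through_opposite hp hσ hs0 hs Y.2 v
  rwa [Nat.card_congr (Equiv.subtypeSubtypeEquivSubtypeInter (IsHermGenerator σ)
    fun g => v ∈ g ∧ Y.1 ⊓ g = ⊥)]

theorem hermOppositeness_col_mem_span [Fintype F] {p : ℕ} [CharP F p] (hp : p.Prime)
    (hσ : ∀ a, σ (σ a) = a) {s : F} (hs0 : s ≠ 0) (hs : σ s = -s)
    (Y L : {W // IsHermGenerator σ W}) :
    (hermOppositeness σ).col L ∈ Submodule.span F
      ((hermOppositeness σ).col '' {g | g.1 ⊓ Y.1 = ⊥}) := by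
  classical
  have : Fintype {W // IsHermGenerator σ W} := Fintype.ofFinite _
  have key : ∀ (v : Fin 4 → F) (L : {W // IsHermGenerator σ W}), v ∈ L.1 →
      (∀ g : {W // IsHermGenerator σ W}, v ∈ g.1 → g ≠ L →
        (hermOppositeness σ).col g ∈ Submodule.span F
          ((hermOppositeness σ).col '' {g | g.1 ⊓ Y.1 = ⊥})) →
      (hermOppositeness σ).col L ∈ Submodule.span F
        ((hermOppositeness σ).col '' {g | g.1 ⊓ Y.1 = ⊥}) := by
    intro v L hL h
    have h0 := sum_hermOppositeness_through_eq_zero (σ := σ) hp hσ hs0 hs v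
    rw [← Finset.add_sum_erase _ _ (by simpa using hL), add_eq_zero_iff_eq_neg] at h0
    rw [h0]
    refine Submodule.neg_mem _ (Submodule.sum_mem _ fun g hg => ?_)
    simp only [Finset.mem_erase, Finset.mem_filter, Finset.mem_univ, true_and] at hg
    exact h g hg.2 hg.1
  have hne : ∀ L : {W // IsHermGenerator σ W}, L ≠ Y → (hermOppositeness σ).col L ∈
      Submodule.span F ((hermOppositeness σ).col '' {g | g.1 ⊓ Y.1 = ⊥}) := by
    intro L hLY
    by_cases hL : L.1 ⊓ Y.1 = ⊥
    · exact Submodule.subset_span ⟨L, hL, rfl⟩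
    have hnle : ¬ L.1 ≤ Y.1 := fun hle =>
      hLY (Subtype.ext (Submodule.eq_of_le_of_finrank_eq hle (L.2.1.trans Y.2.1.symm)))
    obtain ⟨v, hvL, hvY⟩ := Set.not_subset.1 hnle
    refine key v L hvL fun g hg hgL => Submodule.subset_span ⟨g, ?_, rfl⟩
    by_contra hgY
    exact hgL (Subtype.ext
      (IsHermGenerator.eq_of_mem_of_inf_ne_bot hσ Y.2 g.2 L.2 hvY hg hvL hgY hL))
  by_cases hL : L = Y
  · subst hL
    exact key 0 L (zero_mem _) fun g _ hg => hne g hg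
  · exact hne L hL

end oppositeness

section chart

variable {F : Type*} [Field F]

/-- Two dual pairs of isotropic vectors. -/
structure IsHermFrame (σ : F →+* F) (e₀ e₁ f₀ f₁ : Fin 4 → F) : Prop where
  e₀e₀ : hermForm σ e₀ e₀ = 0
  e₀e₁ : hermForm σ e₀ e₁ = 0
  e₁e₁ : hermForm σ e₁ e₁ = 0
  f₀f₀ : hermForm σ f₀ f₀ = 0
  f₀f₁ : hermForm σ f₀ f₁ = 0
  f₁f₁ : hermForm σ f₁ f₁ = 0
  e₀f₀ : hermForm σ e₀ f₀ = 1
  e₀f₁ : hermForm σ e₀ f₁ = 0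
  e₁f₀ : hermForm σ e₁ f₀ = 0
  e₁f₁ : hermForm σ e₁ f₁ = 1

theorem exists_isHermFrame {σ : F →+* F} {ε η : F} (hε : ε * σ ε = -1)
    (hη : η * σ η = 1) (hη1 : η ≠ 1) : ∃ e₀ e₁ f₀ f₁, IsHermFrame σ e₀ e₁ f₀ f₁ := by
  have hc : 1 - η ≠ 0 := sub_ne_zero.2 hη1.symm
  obtain ⟨c, hc⟩ : ∃ c, c * (1 - η) = 1 := ⟨(1 - η)⁻¹, inv_mul_cancel₀ hc⟩
  have hc' : σ c * (1 - σ η) = 1 := by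
    rw [← map_one σ, ← map_sub, ← map_mul, hc]
  have h1 : 1 + ε * σ ε = 0 := by rw [hε, add_neg_cancel]
  have h2 : σ c * (1 + ε * (σ ε * σ η)) = 1 := by
    linear_combination hc' + σ c * σ η * hε
  have h3 : 1 + ε * η * (σ ε * σ η) = 0 := by
    linear_combination (η * σ η) * hε - hη
  refine ⟨![1, ε, 0, 0], ![0, 0, 1, ε], c • ![1, ε * η, 0, 0], c • ![0, 0, 1, ε * η], ?_⟩
  constructor <;>
    (try simp only [hermForm_smul_left, hermForm_smul_right]) <;>
    simp [hermForm, Fin.sum_univ_four, h1, h2, h3]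

theorem isHermGenerator_span_pair {σ : F →+* F} (hσ : ∀ a, σ (σ a) = a) {x y : Fin 4 → F}
    (hx : hermForm σ x x = 0) (hy : hermForm σ y y = 0) (hxy : hermForm σ x y = 0)
    (hind : LinearIndependent F ![x, y]) : IsHermGenerator σ (Submodule.span F {x, y}) := by
  have hyx : hermForm σ y x = 0 := by rw [← map_hermForm hσ, hxy, map_zero]
  refine ⟨?_, fun a ha b hb => ?_⟩
  · have := finrank_span_eq_card hind
    rwa [Matrix.range_cons, Matrix.range_cons, Matrix.range_empty, Set.union_empty,
      Set.singleton_union, Fintype.card_fin] at this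
  · rw [Submodule.mem_span_pair] at ha hb
    obtain ⟨a, b, rfl⟩ := ha
    obtain ⟨c, d, rfl⟩ := hb
    simp [hermForm_add_left, hermForm_add_right, hermForm_smul_left, hermForm_smul_right, hx, hy,
      hxy, hyx]

namespace IsHermFrame

variable {σ : F →+* F} {e₀ e₁ f₀ f₁ : Fin 4 → F}

theorem swap_apply (hσ : ∀ a, σ (σ a) = a) (h : IsHermFrame σ e₀ e₁ f₀ f₁) :
    hermForm σ e₁ e₀ = 0 ∧ hermForm σ f₁ f₀ = 0 ∧ hermForm σ f₀ e₀ = 1 ∧ hermForm σ f₁ e₀ = 0 ∧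
      hermForm σ f₀ e₁ = 0 ∧ hermForm σ f₁ e₁ = 1 := by
  simp only [← map_hermForm hσ e₀ e₁, ← map_hermForm hσ f₀ f₁, ← map_hermForm hσ e₀ f₀,
    ← map_hermForm hσ e₀ f₁, ← map_hermForm hσ e₁ f₀, ← map_hermForm hσ e₁ f₁, h.e₀e₁, h.f₀f₁,
    h.e₀f₀, h.e₀f₁, h.e₁f₀, h.e₁f₁, map_zero, map_one, and_self]

theorem isHermGenerator_span (hσ : ∀ a, σ (σ a) = a) (h : IsHermFrame σ e₀ e₁ f₀ f₁) :
    IsHermGenerator σ (Submodule.span F {f₀, f₁}) := by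
  obtain ⟨-, -, h1, h2, h3, h4⟩ := h.swap_apply hσ
  refine isHermGenerator_span_pair hσ h.f₀f₀ h.f₁f₁ h.f₀f₁ ?_
  rw [LinearIndependent.pair_iff]
  intro a b hab
  have k0 : hermForm σ (a • f₀ + b • f₁) e₀ = 0 := by rw [hab]; simp [hermForm]
  have k1 : hermForm σ (a • f₀ + b • f₁) e₁ = 0 := by rw [hab]; simp [hermForm]
  simp only [hermForm_add_left, hermForm_smul_left, h1, h2, h3, h4, mul_one, mul_zero, add_zero,
    zero_add] at k0 k1
  exact ⟨k0, k1⟩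

/-- Pairings of a vector given by its coordinates in the frame. -/
theorem hermForm_coordinates (hσ : ∀ a, σ (σ a) = a) (h : IsHermFrame σ e₀ e₁ f₀ f₁)
    (a b c d a' b' c' d' : F) :
    hermForm σ (a • e₀ + b • e₁ + c • f₀ + d • f₁) (a' • e₀ + b' • e₁ + c' • f₀ + d' • f₁) =
      a * σ c' + b * σ d' + c * σ a' + d * σ b' := by
  obtain ⟨h0, h0', h1, h2, h3, h4⟩ := h.swap_apply hσ
  simp only [hermForm_add_left, hermForm_add_right, hermForm_smul_left, hermForm_smul_right, h0,
    h0', h1, h2, h3, h4, h.e₀e₀, h.e₀e₁, h.e₁e₁, h.f₀f₀, h.f₀f₁, h.f₁f₁, h.e₀f₀, h.e₀f₁, h.e₁f₀,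
    h.e₁f₁]
  ring

theorem coordinates_injective (hσ : ∀ a, σ (σ a) = a) (h : IsHermFrame σ e₀ e₁ f₀ f₁)
    {a b c d a' b' c' d' : F} (heq : a • e₀ + b • e₁ + c • f₀ + d • f₁ =
      a' • e₀ + b' • e₁ + c' • f₀ + d' • f₁) : a = a' ∧ b = b' ∧ c = c' ∧ d = d' := by
  have key := fun x y z w : F =>
    (h.hermForm_coordinates hσ a b c d x y z w).symm.trans
      ((congrArg (fun v => hermForm σ v (x • e₀ + y • e₁ + z • f₀ + w • f₁)) heq).trans
        (h.hermForm_coordinates hσ a' b' c' d' x y z w))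
  refine ⟨?_, ?_, ?_, ?_⟩
  · simpa using key 0 0 1 0
  · simpa using key 0 0 0 1
  · simpa using key 1 0 0 0
  · simpa using key 0 1 0 0

end IsHermFrame

/-- The subspace opposite `⟨f₀, f₁⟩` with matrix `(a, b; -σ(b), d)`. -/
def chartSubspace (σ : F →+* F) (e₀ e₁ f₀ f₁ : Fin 4 → F) (a d b : F) :
    Submodule F (Fin 4 → F) :=
  Submodule.span F {(1 : F) • e₀ + (0 : F) • e₁ + a • f₀ + b • f₁,
    (0 : F) • e₀ + (1 : F) • e₁ + (-σ b) • f₀ + d • f₁}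

namespace IsHermFrame

variable {σ : F →+* F} {e₀ e₁ f₀ f₁ : Fin 4 → F}

theorem mem_chartSubspace {a d b : F} {x : Fin 4 → F} :
    x ∈ chartSubspace σ e₀ e₁ f₀ f₁ a d b ↔ ∃ α β : F,
      x = α • e₀ + β • e₁ + (α * a - β * σ b) • f₀ + (α * b + β * d) • f₁ := by
  rw [chartSubspace, Submodule.mem_span_pair]
  refine exists_congr fun α => exists_congr fun β => ?_
  rw [eq_comm]
  refine Eq.congr_right ?_
  module

theorem linearIndependent_pair (hσ : ∀ a, σ (σ a) = a) (h : IsHermFrame σ e₀ e₁ f₀ f₁)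
    (a b c d : F) : LinearIndependent F ![(1 : F) • e₀ + (0 : F) • e₁ + a • f₀ + b • f₁,
      (0 : F) • e₀ + (1 : F) • e₁ + c • f₀ + d • f₁] := by
  rw [LinearIndependent.pair_iff]
  intro α β hαβ
  have := h.coordinates_injective hσ (a := α) (b := β) (c := α * a + β * c) (d := α * b + β * d)
    (a' := 0) (b' := 0) (c' := 0) (d' := 0) (by
      rw [show (0 : F) • e₀ + (0 : F) • e₁ + (0 : F) • f₀ + (0 : F) • f₁ = 0 by simp, ← hαβ]
      module)
  exact ⟨this.1, this.2.1⟩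

theorem isHermGenerator_chartSubspace (hσ : ∀ a, σ (σ a) = a) (h : IsHermFrame σ e₀ e₁ f₀ f₁)
    {a d b : F} (ha : σ a = -a) (hd : σ d = -d) :
    IsHermGenerator σ (chartSubspace σ e₀ e₁ f₀ f₁ a d b) := by
  refine isHermGenerator_span_pair hσ ?_ ?_ ?_ (h.linearIndependent_pair hσ _ _ _ _) <;>
    rw [h.hermForm_coordinates hσ] <;> simp [ha, hd, hσ]

theorem exists_eq_chartSubspace (hσ : ∀ a, σ (σ a) = a) (h : IsHermFrame σ e₀ e₁ f₀ f₁)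
    {W : Submodule F (Fin 4 → F)} (hW : IsHermGenerator σ W)
    (hdisj : W ⊓ Submodule.span F {f₀, f₁} = ⊥) :
    ∃ a d b : F, σ a = -a ∧ σ d = -d ∧ chartSubspace σ e₀ e₁ f₀ f₁ a d b = W := by
  have htop : W ⊔ Submodule.span F {f₀, f₁} = ⊤ := by
    apply Submodule.eq_top_of_finrank_eq
    have := Submodule.finrank_sup_add_finrank_inf_eq W (Submodule.span F {f₀, f₁})
    rw [hdisj, hW.1, (h.isHermGenerator_span hσ).1, finrank_bot] at this
    simpa using this
  have hex : ∀ x : Fin 4 → F, ∃ a b : F, x + a • f₀ + b • f₁ ∈ W := by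
    intro x
    obtain ⟨w, hw, l, hl, rfl⟩ := Submodule.mem_sup.1 (htop ▸ Submodule.mem_top : x ∈ _)
    obtain ⟨a, b, rfl⟩ := Submodule.mem_span_pair.1 hl
    refine ⟨-a, -b, ?_⟩
    convert hw using 1
    module
  obtain ⟨a, b, hab⟩ := hex e₀
  obtain ⟨c, d, hcd⟩ := hex e₁
  replace hab : (1 : F) • e₀ + (0 : F) • e₁ + a • f₀ + b • f₁ ∈ W := by simpa using hab
  replace hcd : (0 : F) • e₀ + (1 : F) • e₁ + c • f₀ + d • f₁ ∈ W := by simpa using hcd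
  have h1 := hW.2 _ hab _ hab
  have h2 := hW.2 _ hcd _ hcd
  have h3 := hW.2 _ hcd _ hab
  simp only [h.hermForm_coordinates hσ, map_one, map_zero, one_mul, zero_mul, mul_one, mul_zero,
    add_zero, zero_add] at h1 h2 h3
  obtain rfl : c = -σ b := by linear_combination h3
  exact ⟨a, d, b, by linear_combination h1, by linear_combination h2,
    span_pair_eq_of_finrank_eq_two hW.1 hab hcd (h.linearIndependent_pair hσ _ _ _ _)⟩

theorem chartSubspace_inf_eq_bot_iff (hσ : ∀ a, σ (σ a) = a) (h : IsHermFrame σ e₀ e₁ f₀ f₁)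
    (a d b a' d' b' : F) :
    chartSubspace σ e₀ e₁ f₀ f₁ a d b ⊓ chartSubspace σ e₀ e₁ f₀ f₁ a' d' b' = ⊥ ↔
      (a - a') * (d - d') + (b - b') * (σ b - σ b') ≠ 0 := by
  constructor
  · intro hbot hD
    obtain ⟨α, β, hne, hα, hβ⟩ : ∃ α β : F, ¬(α = 0 ∧ β = 0) ∧
        α * (a - a') = β * (σ b - σ b') ∧ α * (b - b') + β * (d - d') = 0 := by
      by_cases h0 : d - d' = 0 ∧ -(b - b') = 0
      · have hb : b = b' := sub_eq_zero.1 (neg_eq_zero.1 h0.2)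
        exact ⟨0, 1, by simp, by simp [hb], by simp [h0.1]⟩
      · exact ⟨_, _, h0, by linear_combination hD, by ring⟩
    have hmem : α • e₀ + β • e₁ + (α * a - β * σ b) • f₀ + (α * b + β * d) • f₁ ∈
        chartSubspace σ e₀ e₁ f₀ f₁ a d b ⊓ chartSubspace σ e₀ e₁ f₀ f₁ a' d' b' := by
      refine ⟨mem_chartSubspace.2 ⟨α, β, rfl⟩, mem_chartSubspace.2 ⟨α, β, ?_⟩⟩
      rw [show α * a - β * σ b = α * a' - β * σ b' by linear_combination hα,
        show α * b + β * d = α * b' + β * d' by linear_combination hβ]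
    rw [hbot, Submodule.mem_bot] at hmem
    have := h.coordinates_injective hσ (a' := 0) (b' := 0) (c' := 0) (d' := 0)
      (hmem.trans (by simp))
    exact hne ⟨this.1, this.2.1⟩
  · intro hD
    rw [eq_bot_iff]
    rintro x ⟨hx, hx'⟩
    obtain ⟨α, β, rfl⟩ := mem_chartSubspace.1 hx
    obtain ⟨α', β', heq⟩ := mem_chartSubspace.1 hx'
    obtain ⟨rfl, rfl, h1, h2⟩ := h.coordinates_injective hσ heq
    have hα : α * ((a - a') * (d - d') + (b - b') * (σ b - σ b')) = 0 := by
      linear_combination (d - d') * h1 + (σ b - σ b') * h2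
    have hβ : β * ((a - a') * (d - d') + (b - b') * (σ b - σ b')) = 0 := by
      linear_combination (a - a') * h2 - (b - b') * h1
    obtain rfl := (mul_eq_zero.1 hα).resolve_right hD
    obtain rfl := (mul_eq_zero.1 hβ).resolve_right hD
    simp

end IsHermFrame

/-- The norm equations used to split the form. -/
theorem exists_norm_eq_neg_one_and_norm_eq_one [Fintype F] {q : ℕ} (hq : 1 < q)
    (hF : Fintype.card F = q ^ 2) (hneg : (-1 : F) ^ q = -1) :
    ∃ ε η : F, ε * ε ^ q = -1 ∧ η * η ^ q = 1 ∧ η ≠ 1 := by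
  classical
  obtain ⟨g, hg⟩ := IsCyclic.exists_generator (α := Fˣ)
  obtain ⟨m, rfl⟩ : ∃ m, q = m + 1 := ⟨q - 1, by omega⟩
  have hord : orderOf g = m * (m + 2) := by
    rw [orderOf_eq_card_of_forall_mem_zpowers hg, Nat.card_eq_fintype_card,
      Fintype.card_units, hF]
    rw [show (m + 1) ^ 2 = m * (m + 2) + 1 by ring, Nat.add_sub_cancel]
  have hm : 0 < m := by omega
  obtain ⟨k, hk⟩ : ∃ k : ℕ, g ^ k = (-1 : Fˣ) := by
    have := (mem_powers_iff_mem_zpowers (x := g) (y := (-1 : Fˣ))).2 (hg _)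
    exact this
  have hdvd : m * (m + 2) ∣ m * k := by
    rw [← hord, orderOf_dvd_iff_pow_eq_one]
    have h1 : (-1 : Fˣ) ^ (m + 1) = -1 := by
      ext
      simpa using hneg
    rw [mul_comm, pow_mul, hk]
    rw [pow_succ] at h1
    exact mul_eq_right.1 h1
  obtain ⟨j, rfl⟩ := Nat.dvd_of_mul_dvd_mul_left hm hdvd
  refine ⟨((g ^ j : Fˣ) : F), ((g ^ m : Fˣ) : F), ?_, ?_, ?_⟩
  · rw [← pow_succ', ← Units.val_pow_eq_pow_val, ← pow_mul,
      show j * (m + 1 + 1) = (m + 2) * j by ring, hk]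
    simp
  · rw [← pow_succ', ← Units.val_pow_eq_pow_val, ← pow_mul, show m + 1 + 1 = m + 2 by ring, ← hord,
      pow_orderOf_eq_one, Units.val_one]
  · intro h1
    have h2 := orderOf_dvd_of_pow_eq_one (Units.val_eq_one.1 h1)
    rw [hord] at h2
    have := Nat.le_of_dvd hm h2
    nlinarith

end chart

/-- The rank of the oppositeness matrix over the ground field. -/
theorem rank_hermOppositeness {F : Type*} [Field F] [Fintype F] {p t : ℕ} [CharP F p]
    (hp : p.Prime) (ht : 1 ≤ t) (hF : Fintype.card F = (p ^ t) ^ 2) {σ : F →+* F}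
    (hσq : ∀ a, σ a = a ^ p ^ t) [Fintype {W // IsHermGenerator σ W}] :
    (hermOppositeness σ).rank = (detWeights p).card ^ t := by
  classical
  have hσ : ∀ a, σ (σ a) = a := fun a => by
    rw [hσq, hσq, ← pow_mul, ← sq, ← hF, FiniteField.pow_card]
  have hq : 1 < p ^ t := Nat.one_lt_pow (by omega) hp.one_lt
  obtain ⟨s, hs0, hs⟩ : ∃ s : F, s ≠ 0 ∧ σ s = -s := by
    have hcard := card_pow_eq_neg_ge (F := F) hp ht hF
    have : Nontrivial {a : F // a ^ p ^ t = -a} :=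
      Fintype.one_lt_card_iff_nontrivial.1 (hq.trans_le hcard)
    obtain ⟨s, hs⟩ := exists_ne (⟨0, by simp [hp.ne_zero]⟩ : {a : F // a ^ p ^ t = -a})
    exact ⟨s, fun h => hs (Subtype.ext h), (hσq _).trans s.2⟩
  have hneg : (-1 : F) ^ p ^ t = -1 := by rw [← hσq, map_neg, map_one]
  obtain ⟨ε, η, hε, hη, hη1⟩ := exists_norm_eq_neg_one_and_norm_eq_one hq hF hneg
  rw [← hσq] at hε hη
  obtain ⟨e₀, e₁, f₀, f₁, h⟩ := exists_isHermFrame hε hη hη1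
  let S : {a : F // a ^ p ^ t = -a} × {a : F // a ^ p ^ t = -a} × F →
      {W // IsHermGenerator σ W} := fun u =>
    ⟨chartSubspace σ e₀ e₁ f₀ f₁ u.1.1 u.2.1.1 u.2.2, h.isHermGenerator_chartSubspace hσ
      ((hσq _).trans u.1.2) ((hσq _).trans u.2.1.2)⟩
  have hspan := fun L => hermOppositeness_col_mem_span hp hσ hs0 hs
    ⟨_, h.isHermGenerator_span hσ⟩ L
  have hS : ∀ L, (hermOppositeness σ).col L ∈
      Submodule.span F (Set.range fun u => (hermOppositeness σ).col (S u)) := by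
    intro L
    refine Submodule.span_mono ?_ (hspan L)
    rintro _ ⟨g, hg, rfl⟩
    obtain ⟨a, d, b, ha, hd, hW⟩ := h.exists_eq_chartSubspace hσ g.2 hg
    refine ⟨(⟨a, (hσq a).symm.trans ha⟩, ⟨d, (hσq d).symm.trans hd⟩, b), ?_⟩
    exact congrArg _ (Subtype.ext hW)
  rw [← Matrix.rank_submatrix_eq_of_span_col _ hermOppositeness_isSymm S hS,
    ← rank_skewHermitianDetSub_pow hp ht hF]
  congr 1
  ext u v
  have hiff := h.chartSubspace_inf_eq_bot_iff hσ u.1.1 u.2.1.1 u.2.2 v.1.1 v.2.1.1 v.2.2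
  have hD : skewHermitianDetSub (p ^ t) u v = (u.1.1 - v.1.1) * (u.2.1.1 - v.2.1.1) +
      (u.2.2 - v.2.2) * (σ u.2.2 - σ v.2.2) := by
    rw [skewHermitianDetSub, hσq, hσq]
  rw [← hD] at hiff
  have hfix : σ (skewHermitianDetSub (p ^ t) u v) = skewHermitianDetSub (p ^ t) u v := by
    have h1 := (hσq _).trans u.1.2
    have h2 := (hσq _).trans u.2.1.2
    have h3 := (hσq _).trans v.1.2
    have h4 := (hσq _).trans v.2.1.2
    rw [hD]
    simp only [map_add, map_mul, map_sub, hσ, h1, h2, h3, h4]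
    ring
  simp only [Matrix.submatrix_apply, hermOppositeness, Matrix.of_apply, S, hiff]
  by_cases h0 : skewHermitianDetSub (p ^ t) u v = 0
  · rw [if_neg (not_not.2 h0), h0, zero_pow (by omega)]
  · rw [if_pos h0]
    rw [hσq] at hfix
    refine (mul_right_cancel₀ h0 ?_).symm
    rw [← pow_succ, Nat.sub_add_cancel hq.le, hfix, one_mul]

/-- With `q = pᵗ`, the `p`-rank of the oppositeness matrix of lines of `H(3, q²)` is
`((2p³ + p)/3)ᵗ`. -/
theorem prank_oppositeness_H3_prime_power (p t : ℕ) (hp : p.Prime) (ht : 1 ≤ t)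
    (F : Type) [Field F] [Fintype F] (hF : Fintype.card F = (p ^ t) ^ 2)
    (G : Type) [Fintype G]
    (e : G ≃ {W : Submodule F (Fin 4 → F) // Module.finrank F W = 2 ∧
      ∀ x ∈ W, ∀ y ∈ W, ∑ i, x i * y i ^ (p ^ t) = 0})
    (A : Matrix G G (ZMod p))
    (hA1 : ∀ a b : G, (e a).1 ⊓ (e b).1 = ⊥ → A a b = 1)
    (hA0 : ∀ a b : G, (e a).1 ⊓ (e b).1 ≠ ⊥ → A a b = 0) :
    A.rank = ((2 * p ^ 3 + p) / 3) ^ t := by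
  classical
  have : Fact p.Prime := ⟨hp⟩
  have : CharP F p := charP_of_card_eq_prime_pow (f := t * 2) (by rw [hF, pow_mul])
  have hσq : ∀ a, iterateFrobenius F p t a = a ^ p ^ t := fun a => iterateFrobenius_def p t a
  have hW : ∀ W : Submodule F (Fin 4 → F), (Module.finrank F W = 2 ∧
      ∀ x ∈ W, ∀ y ∈ W, ∑ i, x i * y i ^ (p ^ t) = 0) ↔
      IsHermGenerator (iterateFrobenius F p t) W := fun W => by
    simp only [IsHermGenerator, hermForm, hσq]
  let e' : G ≃ {W // IsHermGenerator (iterateFrobenius F p t) W} :=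
    e.trans (Equiv.subtypeEquivRight hW)
  have : Fintype {W // IsHermGenerator (iterateFrobenius F p t) W} := Fintype.ofEquiv G e'
  have hmap : A.map (ZMod.castHom dvd_rfl F) =
      (hermOppositeness (iterateFrobenius F p t)).submatrix e' e' := by
    ext a b
    change ZMod.castHom dvd_rfl F (A a b) = if (e a).1 ⊓ (e b).1 = ⊥ then 1 else 0
    split_ifs with hab
    · rw [hA1 a b hab, map_one]
    · rw [hA0 a b hab, map_zero]
  rw [← Matrix.rank_map_of_field (ZMod.castHom dvd_rfl F), hmap, Matrix.rank_submatrix,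
    rank_hermOppositeness hp ht hF hσq, ← three_mul_card_detWeights,
    Nat.mul_div_cancel_left _ three_pos]
end

section
/- Let p be a prime, t ≥ 1, q = p^t, and let d ≥ 2 be even. The rank over the field with p elements of the oppositeness matrix of generators of the Hermitian polar space H(2d-1, q^2) is at most (p^{2d-1} - p·(p^{2d-2} - 1)/(p + 1))^t. -/
namespace OppositenessRank

open Finset MvPolynomial

theorem rank_le_rank_map {K L m : Type*} [Field K] [Field L] [Fintype m] [DecidableEq m]
    (f : K →+* L) (A : Matrix m m K) : A.rank ≤ (A.map f).rank := by
  obtain ⟨V, U, e, -, -, h⟩ := A.exists_rank_normal_form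
  set g : Fin A.rank → m := fun i => e.symm (Sum.inl i)
  have h1 : V.submatrix g id * A * U.submatrix id g = 1 := by
    have : (V * A * U).submatrix g g = 1 := by
      rw [h]
      ext i j
      simp [g]
    rw [← this]
    ext i j
    simp [Matrix.mul_apply]
  have h2 := congrArg (fun M => M.map f) h1
  simp only [Matrix.map_mul, Matrix.map_one f (map_zero f) (map_one f)] at h2
  calc A.rank = (1 : Matrix (Fin A.rank) (Fin A.rank) L).rank := by simp
    _ ≤ (A.map f).rank := by
        rw [← h2]
        exact (Matrix.rank_mul_le_left _ _).trans (Matrix.rank_mul_le_right _ _)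

/-- A matrix whose entries are, up to row and column scalars, products of Frobenius twists of a
matrix factoring through `S` has rank at most `|S| ^ t`. -/
theorem rank_hadamard_frobenius_le {K G S : Type*} [Field K] [Fintype G] [Fintype S]
    (p t : ℕ) [ExpChar K p] (f g : G → S → K) (α β : G → K) :
    (Matrix.of fun a b => α a * β b * ∏ i : Fin t, (∑ s, f a s * g b s) ^ p ^ (i : ℕ)).rank
      ≤ Fintype.card S ^ t := by
  have key : (Matrix.of fun a b => α a * β b * ∏ i : Fin t, (∑ s, f a s * g b s) ^ p ^ (i : ℕ))
      = (Matrix.of fun a (φ : Fin t → S) => α a * ∏ i, f a (φ i) ^ p ^ (i : ℕ)) *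
        (Matrix.of fun (φ : Fin t → S) b => β b * ∏ i, g b (φ i) ^ p ^ (i : ℕ)) := by
    classical
    ext a b
    simp only [Matrix.of_apply, Matrix.mul_apply, sum_pow_char_pow, Finset.prod_univ_sum,
      Fintype.piFinset_univ, Finset.mul_sum, mul_pow, Finset.prod_mul_distrib]
    exact Finset.sum_congr rfl fun φ _ => by ring
  classical
  rw [key]
  refine (Matrix.rank_mul_le_left _ _).trans ((Matrix.rank_le_card_width _).trans ?_)
  simp

theorem card_sum_eq_zero_succ (M : Type*) [AddCommGroup M] [Fintype M] [DecidableEq M] (n : ℕ) :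
    Fintype.card {g : Fin (n + 1) → {x : M // x ≠ 0} // ∑ i, (g i : M) = 0} +
      Fintype.card {g : Fin n → {x : M // x ≠ 0} // ∑ i, (g i : M) = 0} =
        (Fintype.card M - 1) ^ n := by
  have e : {g : Fin (n + 1) → {x : M // x ≠ 0} // ∑ i, (g i : M) = 0} ≃
      {g : Fin n → {x : M // x ≠ 0} // ¬ ∑ i, (g i : M) = 0} :=
    { toFun g := ⟨Fin.tail g.1, fun h => (g.1 0).2 (by
        have := g.2
        rw [Fin.sum_univ_succ] at this
        change ∑ i : Fin n, (g.1 i.succ : M) = 0 at h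
        rwa [h, add_zero] at this)⟩
      invFun g := ⟨Fin.cons ⟨-∑ i, (g.1 i : M), neg_ne_zero.2 g.2⟩ g.1, by
        simp [Fin.sum_univ_succ]⟩
      left_inv g := by
        have := g.2
        rw [Fin.sum_univ_succ] at this
        ext i
        refine Fin.cases ?_ (fun i => ?_) i
        · simpa [Fin.tail] using (eq_neg_of_add_eq_zero_left this).symm
        · simp [Fin.tail]
      right_inv g := by
        ext i
        simp }
  rw [Fintype.card_congr e, Fintype.card_subtype_compl, Nat.sub_add_cancel
    (Fintype.card_subtype_le _)]
  simp [Fintype.card_subtype_compl]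

theorem card_sum_eq_zero_even (p k : ℕ) (hp0 : p ≠ 0) :
    Fintype.card {g : Fin (2 * (k + 1)) → {x : ZMod (p + 1) // x ≠ 0} //
        ∑ i, (g i : ZMod (p + 1)) = 0}
      = p ^ (2 * k + 1) - p * ((p ^ (2 * k) - 1) / (p + 1)) := by
  have hrec (n : ℕ) := card_sum_eq_zero_succ (ZMod (p + 1)) n
  simp only [ZMod.card, Nat.add_sub_cancel] at hrec
  have odd : ∃ b, Fintype.card {g : Fin (2 * k + 1) → {x : ZMod (p + 1) // x ≠ 0} //
      ∑ i, (g i : ZMod (p + 1)) = 0} = p * b ∧ p ^ (2 * k) = (p + 1) * b + 1 := by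
    induction k with
    | zero =>
      refine ⟨0, ?_, by simp⟩
      refine (Fintype.card_eq_zero_iff.2 ?_).trans (mul_zero p).symm
      exact ⟨fun g => (g.1 0).2 (by simpa using g.2)⟩
    | succ k ih =>
      obtain ⟨b, hb, hp⟩ := ih
      have h1 := hrec (2 * k + 1)
      have h2 := hrec (2 * k + 2)
      rw [hb] at h1
      have h3 : p ^ (2 * k + 1) = p * ((p + 1) * b + 1) := by rw [pow_succ, hp, mul_comm]
      have h4 : p ^ (2 * k + 2) = p * (p * ((p + 1) * b + 1)) := by
        rw [pow_succ, h3, mul_comm]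
      rcases p with _ | p
      · exact absurd rfl hp0
      refine ⟨p * ((p + 2) * b + 1) + b, ?_, ?_⟩
      · change Fintype.card {g : Fin (2 * k + 2 + 1) → {x : ZMod (p + 1 + 1) // x ≠ 0} //
          ∑ i, (g i : ZMod (p + 1 + 1)) = 0} = _
        change Fintype.card {g : Fin (2 * k + 2) → {x : ZMod (p + 1 + 1) // x ≠ 0} //
          ∑ i, (g i : ZMod (p + 1 + 1)) = 0} + _ = _ at h1
        nlinarith
      · rw [show 2 * (k + 1) = 2 * k + 2 by ring, h4]
        ring
  obtain ⟨b, hb, hp⟩ := odd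
  have h1 := hrec (2 * k + 1)
  rw [hb] at h1
  rw [hp, Nat.add_sub_cancel, Nat.mul_div_cancel_left _ (Nat.succ_pos p), ← h1]
  exact (Nat.add_sub_cancel _ _).symm

section LinearForms

variable {K n : Type*} [Field K] [Fintype n]

/-- The product of the `(p - 1)`-st powers of the linear forms given by the columns of `M`. -/
noncomputable def formProd {m : Type*} [Fintype m] (p : ℕ) (M : Matrix n m K) : MvPolynomial n K :=
  ∏ j, (∑ i, C (M i j) * X i) ^ (p - 1)

/-- The exponent vector all of whose entries are `p - 1`. -/
noncomputable def topExp (n : Type*) [Finite n] (p : ℕ) : n →₀ ℕ :=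
  Finsupp.equivFunOnFinite.symm fun _ => p - 1

theorem topExp_apply (p : ℕ) (i : n) : topExp n p i = p - 1 := rfl

theorem formProd_isHomogeneous {m : Type*} [Fintype m] (p : ℕ) (M : Matrix n m K) :
    (formProd p M).IsHomogeneous (Fintype.card m * (p - 1)) := by
  have := IsHomogeneous.prod (Finset.univ : Finset m)
    (fun j => (∑ i, C (M i j) * X i : MvPolynomial n K) ^ (p - 1)) (fun _ => p - 1) fun j _ => by
      have : (∑ i, C (M i j) * X i : MvPolynomial n K).IsHomogeneous 1 :=
        IsHomogeneous.sum _ _ _ fun i _ => isHomogeneous_C_mul_X _ _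
      simpa using this.pow (p - 1)
  simpa [formProd] using this

theorem formProd_fromCols {m₁ m₂ : Type*} [Fintype m₁] [Fintype m₂] (p : ℕ) (M : Matrix n m₁ K)
    (N : Matrix n m₂ K) : formProd p (M.fromCols N) = formProd p M * formProd p N := by
  simp [formProd]

theorem coeff_topExp_mul_form_pow (p : ℕ) [Fact p.Prime] [CharP K p] (v : n → K)
    (f : MvPolynomial n K) : coeff (topExp n p) (f * (∑ i, C (v i) * X i) ^ p) = 0 := by
  rw [sum_pow_char, Finset.mul_sum, coeff_sum]
  refine Finset.sum_eq_zero fun i _ => ?_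
  rw [mul_pow, ← C_pow, mul_left_comm, coeff_C_mul, X_pow_eq_monomial, coeff_mul_monomial',
    if_neg, mul_zero]
  intro h
  have := h i
  have hp := (Fact.out : p.Prime).pos
  rw [Finsupp.single_eq_same, topExp_apply] at this
  omega

variable [DecidableEq n]

theorem coeff_formProd_mul_transvection (p : ℕ) [Fact p.Prime] [CharP K p] (M : Matrix n n K)
    {i j : n} (hij : i ≠ j) (c : K) :
    coeff (topExp n p) (formProd p (M * Matrix.transvection i j c)) =
      coeff (topExp n p) (formProd p M) := by
  set ℓ : n → MvPolynomial n K := fun k => ∑ l, C (M l k) * X l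
  have hj : ∑ l, C ((M * Matrix.transvection i j c) l j) * X l = ℓ j + C c * ℓ i := by
    simp only [Matrix.mul_transvection_apply_same, ℓ, Finset.mul_sum, ← Finset.sum_add_distrib]
    refine Finset.sum_congr rfl fun l _ => ?_
    simp only [map_add, map_mul]
    ring
  have hk (k : n) (hk : k ≠ j) :
      ∑ l, C ((M * Matrix.transvection i j c) l k) * X l = ℓ k := by
    simp only [Matrix.mul_transvection_apply_of_ne _ _ _ _ hk, ℓ]
  obtain ⟨g, hg⟩ := sub_dvd_pow_sub_pow (ℓ j + C c * ℓ i) (ℓ j) (p - 1)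
  have hi : i ∈ Finset.univ.erase j := by simp [hij]
  have h1 : formProd p M = ℓ j ^ (p - 1) * ∏ k ∈ Finset.univ.erase j, ℓ k ^ (p - 1) :=
    (Finset.mul_prod_erase _ _ (Finset.mem_univ j)).symm
  have h2 : formProd p (M * Matrix.transvection i j c) =
      (ℓ j + C c * ℓ i) ^ (p - 1) * ∏ k ∈ Finset.univ.erase j, ℓ k ^ (p - 1) := by
    rw [formProd, ← Finset.mul_prod_erase _ _ (Finset.mem_univ j), hj]
    congr 1
    exact Finset.prod_congr rfl fun k hk' => by rw [hk k (Finset.ne_of_mem_erase hk')]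
  rw [← sub_eq_zero, ← coeff_sub, h1, h2, ← sub_mul, hg, ← Finset.mul_prod_erase _ _ hi]
  have hp : ℓ i ^ p = ℓ i * ℓ i ^ (p - 1) := by
    rw [← pow_succ', Nat.sub_add_cancel (Fact.out : p.Prime).one_le]
  rw [show ∀ P : MvPolynomial n K, (ℓ j + C c * ℓ i - ℓ j) * g * (ℓ i ^ (p - 1) * P) =
    C c * g * P * ℓ i ^ p from fun P => by rw [hp]; ring]
  exact coeff_topExp_mul_form_pow p _ _

theorem formProd_mul_diagonal (p : ℕ) (M : Matrix n n K) (D : n → K) :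
    formProd p (M * Matrix.diagonal D) = C ((∏ i, D i) ^ (p - 1)) * formProd p M := by
  simp only [formProd, Matrix.mul_diagonal, ← Finset.prod_pow, map_prod, ← Finset.prod_mul_distrib]
  refine Finset.prod_congr rfl fun j _ => ?_
  rw [C_pow, ← mul_pow, Finset.mul_sum]
  congr 1
  refine Finset.sum_congr rfl fun i _ => ?_
  rw [map_mul]
  ring

theorem coeff_formProd_mul (p : ℕ) [Fact p.Prime] [CharP K p] (N M : Matrix n n K) :
    coeff (topExp n p) (formProd p (M * N)) =
      N.det ^ (p - 1) * coeff (topExp n p) (formProd p M) := by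
  induction N using Matrix.diagonal_transvection_induction generalizing M with
  | hdiag D _ => rw [formProd_mul_diagonal, coeff_C_mul, Matrix.det_diagonal]
  | htransvec t =>
    rw [t.det, one_pow, one_mul]
    exact coeff_formProd_mul_transvection p M t.hij t.c
  | hmul A B hA hB => rw [← mul_assoc, hB, hA, Matrix.det_mul]; ring

/-- In characteristic `p`, the coefficient of `∏ xᵢ ^ (p - 1)` in the product of the `(p - 1)`-st
powers of the columns of a square matrix is the `(p - 1)`-st power of its determinant. -/
theorem coeff_formProd (p : ℕ) [Fact p.Prime] [CharP K p] (M : Matrix n n K) :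
    coeff (topExp n p) (formProd p M) = M.det ^ (p - 1) := by
  have h1 : formProd p (1 : Matrix n n K) = monomial (topExp n p) 1 := by
    rw [monomial_eq, Finsupp.prod_fintype _ _ (fun _ => pow_zero _), map_one, one_mul]
    refine Finset.prod_congr rfl fun j _ => ?_
    simp [Matrix.one_apply, ite_mul, topExp_apply]
  rw [← one_mul M, coeff_formProd_mul, h1, coeff_monomial, if_pos rfl, mul_one, one_mul]

end LinearForms

/-- The exponent pairs that contribute to the pairing of two products of `(p - 1)`-st powers. -/
noncomputable def halfExp (m : Type*) [Fintype m] [DecidableEq m] (p : ℕ) :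
    Finset ((m ⊕ m →₀ ℕ) × (m ⊕ m →₀ ℕ)) :=
  (Finset.HasAntidiagonal.antidiagonal (topExp (m ⊕ m) p)).filter
    fun s => s.1.degree = Fintype.card m * (p - 1)

variable {K m : Type*} [Field K] [Fintype m] [DecidableEq m]

theorem det_fromCols_pow (p : ℕ) [Fact p.Prime] [CharP K p] (M N : Matrix (m ⊕ m) m K) :
    (M.fromCols N).det ^ (p - 1) =
      ∑ s : halfExp m p, coeff s.1.1 (formProd p M) * coeff s.1.2 (formProd p N) := by
  rw [← coeff_formProd, formProd_fromCols, coeff_mul,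
    Finset.sum_coe_sort (halfExp m p) fun s => coeff s.1 (formProd p M) * coeff s.2 (formProd p N),
    halfExp, Finset.sum_filter_of_ne]
  intro s _ h
  by_contra hs
  exact h (by rw [(formProd_isHomogeneous p M).coeff_eq_zero hs, zero_mul])

theorem card_halfExp_le (p d : ℕ) [Fact p.Prime] :
    Fintype.card (halfExp (Fin d) p) ≤
      Fintype.card {g : Fin (2 * d) → {x : ZMod (p + 1) // x ≠ 0} //
        ∑ i, (g i : ZMod (p + 1)) = 0} := by
  have hp := (Fact.out : p.Prime).pos
  let ε : Fin d ⊕ Fin d ≃ Fin (2 * d) := finSumFinEquiv.trans (finCongr (two_mul d).symm)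
  have hle (s : halfExp (Fin d) p) (i) : s.1.1 i + 1 < p + 1 := by
    have h := (Finset.HasAntidiagonal.mem_antidiagonal.1 (Finset.mem_filter.1 s.2).1)
    have h' := DFunLike.congr_fun h i
    rw [Finsupp.add_apply, topExp_apply] at h'
    omega
  have hval (s : halfExp (Fin d) p) (i) :
      (((s.1.1 i + 1 : ℕ) : ZMod (p + 1))).val = s.1.1 i + 1 := ZMod.val_cast_of_lt (hle s i)
  let F : halfExp (Fin d) p → {g : Fin (2 * d) → {x : ZMod (p + 1) // x ≠ 0} //
        ∑ i, (g i : ZMod (p + 1)) = 0} := fun s =>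
    ⟨fun i => ⟨((s.1.1 (ε.symm i) + 1 : ℕ) : ZMod (p + 1)), fun h => by
        have := hval s (ε.symm i)
        rw [h, ZMod.val_zero] at this
        omega⟩, by
      have h := (Finset.mem_filter.1 s.2).2
      rw [Finsupp.degree_eq_sum, Fintype.card_fin] at h
      simp only
      rw [Equiv.sum_comp ε.symm fun i => ((s.1.1 i + 1 : ℕ) : ZMod (p + 1)), ← Nat.cast_sum,
        Finset.sum_add_distrib, h, ZMod.natCast_eq_zero_iff]
      refine ⟨d, ?_⟩
      obtain ⟨k, rfl⟩ := Nat.exists_eq_add_of_le' hp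
      simp
      ring⟩
  refine Fintype.card_le_of_injective F fun s s' h => ?_
  have h1 : s.1.1 = s'.1.1 := by
    ext i
    have := congrArg (fun g => ((g.1 (ε i)).1).val) h
    simp only [F, Equiv.symm_apply_apply, hval] at this
    omega
  have h2 := (Finset.HasAntidiagonal.mem_antidiagonal.1 (Finset.mem_filter.1 s.2).1)
  rw [← (Finset.HasAntidiagonal.mem_antidiagonal.1 (Finset.mem_filter.1 s'.2).1), h1] at h2
  exact Subtype.ext (Prod.ext h1 (add_left_cancel h2))

section Hermitian

variable {F m : Type*} [Field F] [Fintype m] [DecidableEq m]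

open Matrix

theorem det_swapBlocks_ne_zero : (fromBlocks 0 1 1 0 : Matrix (m ⊕ m) (m ⊕ m) F).det ≠ 0 := by
  have h : (fromBlocks 0 1 1 0 : Matrix (m ⊕ m) (m ⊕ m) F) * fromBlocks 0 1 1 0 = 1 := by
    simp [fromBlocks_multiply]
  exact left_ne_zero_of_mul_eq_one ((det_mul _ _).symm.trans ((congrArg det h).trans det_one))

theorem exists_det_gram_eq (φ : F →+* F) {X Z : Matrix (m ⊕ m) m F}
    (hT : (X.fromCols Z).det ≠ 0) (hX : Xᵀ * X.map φ = 0) :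
    ∃ α : F, α ≠ 0 ∧ ∀ Y : Matrix (m ⊕ m) m F,
      (Xᵀ * Y.map φ).det = α * φ (X.fromCols Y).det := by
  set T := X.fromCols Z with hTdef
  have hgram : Tᵀ * T.map φ =
      fromBlocks 0 (Xᵀ * Z.map φ) (Zᵀ * X.map φ) (Zᵀ * Z.map φ) := by
    rw [hTdef, transpose_fromCols, fromCols_map, fromRows_mul_fromCols, hX]
  have hdetmap : (T.map φ).det = φ T.det := (φ.map_det T).symm
  have hB : (Xᵀ * Z.map φ).det ≠ 0 := by
    have h1 : (Tᵀ * T.map φ * fromBlocks 0 1 1 0).det ≠ 0 := by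
      rw [det_mul, det_mul, det_transpose, hdetmap]
      exact mul_ne_zero (mul_ne_zero hT ((map_ne_zero φ).2 hT)) det_swapBlocks_ne_zero
    rw [hgram, fromBlocks_multiply] at h1
    simp only [Matrix.mul_zero, Matrix.mul_one, zero_add, add_zero, det_fromBlocks_zero₁₂] at h1
    exact left_ne_zero_of_mul h1
  refine ⟨(Xᵀ * Z.map φ).det / φ T.det, div_ne_zero hB ((map_ne_zero φ).2 hT), fun Y => ?_⟩
  obtain ⟨U, V, rfl⟩ : ∃ U V : Matrix m m F, Y = X * U + Z * V := by
    refine ⟨(T⁻¹ * Y).toRows₁, (T⁻¹ * Y).toRows₂, ?_⟩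
    rw [← fromCols_mul_fromRows, fromRows_toRows, mul_nonsing_inv_cancel_left _ _ hT.isUnit]
  have h1 : X.fromCols (X * U + Z * V) = T * fromBlocks 1 U 0 V := by
    rw [hTdef, fromCols_mul_fromBlocks]
    simp
  have h2 : Xᵀ * (X * U + Z * V).map φ = Xᵀ * Z.map φ * V.map φ := by
    rw [Matrix.map_add φ (map_add φ), Matrix.map_mul, Matrix.map_mul, Matrix.mul_add,
      ← Matrix.mul_assoc, hX, Matrix.zero_mul, zero_add, Matrix.mul_assoc]
  have hV : (V.map φ).det = φ V.det := (φ.map_det V).symm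
  rw [h1, h2, det_mul, det_mul, det_fromBlocks_zero₂₁, det_one, one_mul, map_mul, hV]
  have := (map_ne_zero φ).2 hT
  field_simp

/-- Up to row and column scalars, the determinants `det [X a | X b]` for totally isotropic `X a`
lie in the fixed field of the involution `φ`. -/
theorem exists_normalizing_scalars {G : Type*} (φ : F →+* F) {q : ℕ} (hq : 1 ≤ q)
    (hφ : ∀ x, φ x = x ^ q) (hφφ : ∀ x, φ (φ x) = x) (X Z : G → Matrix (m ⊕ m) m F)
    (hT : ∀ a, ((X a).fromCols (Z a)).det ≠ 0) (hX : ∀ a, (X a)ᵀ * (X a).map φ = 0) :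
    ∃ α β : G → F, ∀ a b, ((X a).fromCols (X b)).det ≠ 0 →
      α a * β b * ((X a).fromCols (X b)).det ^ (q - 1) = 1 := by
  choose γ hγ hgram using fun a => exists_det_gram_eq φ (hT a) (hX a)
  set ε := (fromBlocks 0 1 1 0 : Matrix (m ⊕ m) (m ⊕ m) F).det with hε
  refine ⟨fun a => (φ (γ a))⁻¹, fun b => γ b * φ ε, fun a b hab => ?_⟩
  have hswap : ((X b).fromCols (X a)).det = ((X a).fromCols (X b)).det * ε := by
    rw [hε, ← det_mul, fromCols_mul_fromBlocks]
    simp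
  have hconj : ((X b)ᵀ * (X a).map φ).det = φ ((X a)ᵀ * (X b).map φ).det := by
    rw [φ.map_det, ← det_transpose]
    congr 1
    ext i j
    simp [Matrix.mul_apply, hφφ, mul_comm]
  rw [hgram, hgram, hswap, map_mul, map_mul, hφφ] at hconj
  set δ := ((X a).fromCols (X b)).det
  rw [hφ δ, ← pow_sub_one_mul (Nat.one_le_iff_ne_zero.1 hq)] at hconj
  have h : γ b * φ ε * δ ^ (q - 1) = φ (γ a) := mul_right_cancel₀ hab (by rw [← hconj]; ring)
  rw [mul_assoc, h, inv_mul_cancel₀ ((map_ne_zero φ).2 (hγ a))]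

end Hermitian

theorem det_fromCols_basis_ne_zero_iff {F m V : Type*} [Field F] [Fintype m] [DecidableEq m]
    [AddCommGroup V] [Module F V] (ψ : V ≃ₗ[F] (m ⊕ m → F)) {W W' : Submodule F V}
    (b : Module.Basis m F W) (b' : Module.Basis m F W') :
    (Matrix.fromCols (Matrix.of fun i j => ψ (b j) i) (Matrix.of fun i j => ψ (b' j) i)).det ≠ 0 ↔
      W ⊓ W' = ⊥ := by
  rw [← isUnit_iff_ne_zero, ← Matrix.isUnit_iff_isUnit_det,
    ← Matrix.linearIndependent_cols_iff_isUnit]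
  have hcol : (Matrix.fromCols (Matrix.of fun i j => ψ (b j) i)
      (Matrix.of fun i j => ψ (b' j) i)).col =
      ψ.toLinearMap ∘ Sum.elim (fun j => (b j : V)) fun j => (b' j : V) := by
    ext (j | j) i <;> rfl
  have hspan {U : Submodule F V} (c : Module.Basis m F U) :
      LinearIndependent F (fun j => (c j : V)) ∧
      Submodule.span F (Set.range fun j => (c j : V)) = U := by
    refine ⟨c.linearIndependent.map' U.subtype U.ker_subtype, ?_⟩
    have := congrArg (Submodule.map U.subtype) c.span_eq
    rwa [Submodule.map_span, Submodule.map_subtype_top, ← Set.range_comp] at this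
  rw [hcol, ψ.toLinearMap.linearIndependent_iff (LinearEquiv.ker ψ), linearIndependent_sum]
  simp only [Sum.elim_comp_inl, Sum.elim_comp_inr, (hspan b).1, (hspan b').1, (hspan b).2,
    (hspan b').2, true_and, disjoint_iff]

theorem prod_pow_frobenius {K : Type*} [CommMonoid K] {p : ℕ} (hp : 1 ≤ p) (t : ℕ) (x : K) :
    ∏ i : Fin t, (x ^ (p - 1)) ^ p ^ (i : ℕ) = x ^ (p ^ t - 1) := by
  obtain ⟨k, rfl⟩ := Nat.exists_eq_add_of_le' hp
  rw [Fin.prod_univ_eq_prod_range (fun i => (x ^ (k + 1 - 1)) ^ (k + 1) ^ i) t,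
    Finset.prod_pow_eq_pow_sum, ← pow_mul, ← geom_sum_mul_add k t, Nat.add_sub_cancel,
    Nat.add_sub_cancel, mul_comm]

theorem rank_oppositeness_le_card_halfExp_pow {p t d : ℕ} (ht : t ≠ 0) [Fact p.Prime] {F : Type*} [Field F]
    [Finite F] (hF : Nat.card F = (p ^ t) ^ 2) {G : Type*} [Fintype G]
    (W : G → Submodule F (Fin (2 * d) → F))
    (hW : ∀ a, Module.finrank F (W a) = d ∧
      ∀ x ∈ W a, ∀ y ∈ W a, ∑ i, x i * y i ^ (p ^ t) = 0)
    (A : Matrix G G (ZMod p)) (hA1 : ∀ a b : G, W a ⊓ W b = ⊥ → A a b = 1)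
    (hA0 : ∀ a b : G, W a ⊓ W b ≠ ⊥ → A a b = 0) :
    A.rank ≤ Fintype.card (halfExp (Fin d) p) ^ t := by
  classical
  have hp : p.Prime := Fact.out
  have := Fintype.ofFinite F
  have hcard : Fintype.card F = p ^ (t * 2) := by rw [← Nat.card_eq_fintype_card, hF, pow_mul]
  have : CharP F p := charP_of_card_eq_prime_pow hcard
  have : ExpChar F p := ExpChar.prime hp
  let ε : Fin d ⊕ Fin d ≃ Fin (2 * d) := finSumFinEquiv.trans (finCongr (two_mul d).symm)
  let ψ := LinearEquiv.funCongrLeft F F ε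
  choose W' hW' using fun a => (W a).exists_isCompl
  have hrank (a : G) : Module.finrank F (W' a) = d := by
    have h := Submodule.finrank_add_eq_of_isCompl (hW' a)
    rw [(hW a).1, Module.finrank_fin_fun] at h
    omega
  let b (a : G) := Module.finBasisOfFinrankEq F (W a) (hW a).1
  let b' (a : G) := Module.finBasisOfFinrankEq F (W' a) (hrank a)
  let X (a : G) : Matrix (Fin d ⊕ Fin d) (Fin d) F := Matrix.of fun i j => ψ (b a j) i
  let Z (a : G) : Matrix (Fin d ⊕ Fin d) (Fin d) F := Matrix.of fun i j => ψ (b' a j) i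
  have hq : p ^ t ≠ 0 := pow_ne_zero _ hp.ne_zero
  obtain ⟨α, β, hαβ⟩ := exists_normalizing_scalars (iterateFrobenius F p t)
    (Nat.one_le_iff_ne_zero.2 hq) (iterateFrobenius_def p t)
    (fun x => by
      rw [iterateFrobenius_def, iterateFrobenius_def, ← pow_mul, ← pow_two, ← hF,
        Nat.card_eq_fintype_card, FiniteField.pow_card]) X Z
    (fun a => (det_fromCols_basis_ne_zero_iff ψ (b a) (b' a)).2 (hW' a).inf_eq_bot)
    (fun a => by
      ext j k
      simp only [Matrix.mul_apply, Matrix.transpose_apply, Matrix.map_apply, Matrix.zero_apply,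
        iterateFrobenius_def, X, Matrix.of_apply]
      exact (Equiv.sum_comp ε fun i => (b a j : Fin (2 * d) → F) i *
        (b a k : Fin (2 * d) → F) i ^ p ^ t).trans
        ((hW a).2 _ (b a j).2 _ (b a k).2))
  refine (rank_le_rank_map (ZMod.castHom dvd_rfl F) A).trans ?_
  have key : A.map (ZMod.castHom dvd_rfl F) = Matrix.of fun a c => α a * β c *
      ∏ i : Fin t, (∑ s : halfExp (Fin d) p, MvPolynomial.coeff s.1.1 (formProd p (X a)) *
        MvPolynomial.coeff s.1.2 (formProd p (X c))) ^ p ^ (i : ℕ) := by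
    ext a c
    rw [Matrix.map_apply, Matrix.of_apply, ← det_fromCols_pow, prod_pow_frobenius hp.one_le]
    have hiff := det_fromCols_basis_ne_zero_iff ψ (b a) (b c)
    by_cases h : W a ⊓ W c = ⊥
    · rw [hA1 a c h, map_one, hαβ a c (hiff.2 h)]
    · have h0 : ((X a).fromCols (X c)).det = 0 := by_contra fun h' => h (hiff.1 h')
      have hpt : p ^ t - 1 ≠ 0 := by
        have := Nat.one_lt_pow ht hp.one_lt
        omega
      rw [hA0 a c h, map_zero, h0, zero_pow hpt, mul_zero]
  rw [key]
  exact rank_hadamard_frobenius_le p t _ _ α β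

end OppositenessRank

/-- For even `d ≥ 2` and `q = pᵗ`, the `p`-rank of the oppositeness matrix of generators of
`H(2d-1, q²)` is at most `(p^(2d-1) - p·(p^(2d-2) - 1)/(p + 1))ᵗ`. -/
theorem prank_oppositeness_hermitian_prime_power_le (p t d : ℕ) (hp : p.Prime) (ht : 1 ≤ t)
    (hd : 2 ≤ d) (hdeven : Even d)
    (F : Type) [Field F] [Fintype F] (hF : Fintype.card F = (p ^ t) ^ 2)
    (G : Type) [Fintype G]
    (e : G ≃ {W : Submodule F (Fin (2 * d) → F) // Module.finrank F W = d ∧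
      ∀ x ∈ W, ∀ y ∈ W, ∑ i, x i * y i ^ (p ^ t) = 0})
    (A : Matrix G G (ZMod p))
    (hA1 : ∀ a b : G, (e a).1 ⊓ (e b).1 = ⊥ → A a b = 1)
    (hA0 : ∀ a b : G, (e a).1 ⊓ (e b).1 ≠ ⊥ → A a b = 0) :
    A.rank ≤ (p ^ (2 * d - 1) - p * ((p ^ (2 * d - 2) - 1) / (p + 1))) ^ t := by
  have := Fact.mk hp
  obtain ⟨k, rfl⟩ : ∃ k, d = k + 1 := ⟨d - 1, by omega⟩
  refine (OppositenessRank.rank_oppositeness_le_card_halfExp_pow (by omega)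
    (Nat.card_eq_fintype_card.trans hF) (fun a => (e a).1) (fun a => (e a).2) A hA1 hA0).trans
    (Nat.pow_le_pow_left ?_ t)
  refine (OppositenessRank.card_halfExp_le p (k + 1)).trans ?_
  rw [OppositenessRank.card_sum_eq_zero_even p k hp.ne_zero]
  exact le_of_eq (by congr 2)
end
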